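/- arXiv:2603.02037 — 4 statements merged into one kernel-verified Lean document; each statement's English description precedes it below -/
import Mathlib

section
/- Let A_1, A_2, B_1, B_2, C_1, C_2 be partitions. If the Littlewood–Richardson coefficients c^{A_1}_{B_1,C_1} and c^{A_2}_{B_2,C_2} are both positive, then c^{A_1+A_2}_{B_1+B_2, C_1+C_2} is positive, where sums of partitions are componentwise. -/
open Finset MvPolynomial

/-- `hp l k` is the complete homogeneous symmetric polynomial `h_k` in `l` variables,
interpreted as `0` for negative `k` (and `h_0 = 1`). -/
noncomputable def hp (l : ℕ) (k : ℤ) : MvPolynomial (Fin l) ℤ :=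
  if 0 ≤ k then MvPolynomial.hsymm (Fin l) ℤ k.toNat else 0

/-- The Schur polynomial of a partition (given as a weakly decreasing `l`-tuple) in `l`
variables, defined by the Jacobi–Trudi determinant `s_A = det (h_{A i - i + j})`. -/
noncomputable def schur (l : ℕ) (A : Fin l → ℕ) : MvPolynomial (Fin l) ℤ :=
  Matrix.det (Matrix.of fun i j : Fin l => hp l ((A i : ℤ) + (j : ℕ) - (i : ℕ)))

/-- The Vandermonde alternant `a_δ = det (x_i ^ (l - 1 - j))`. -/
noncomputable def vdm (l : ℕ) : MvPolynomial (Fin l) ℤ :=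
  Matrix.det (Matrix.of fun i j : Fin l => (X i : MvPolynomial (Fin l) ℤ) ^ (l - 1 - (j : ℕ)))

/-- The multiplicity (coefficient) of the Schur polynomial `s_B` in the expansion of a
symmetric polynomial `P` in the basis of Schur polynomials of partitions of length at most
`l`: it equals the coefficient of the monomial `x ^ (B + δ)` in the alternating polynomial
`P * a_δ`, where `δ = (l-1, l-2, …, 0)`. -/
noncomputable def schurMult (l : ℕ) (B : Fin l → ℕ) (P : MvPolynomial (Fin l) ℤ) : ℤ :=
  MvPolynomial.coeff (Finsupp.equivFunOnFinite.symm fun i : Fin l => B i + (l - 1 - (i : ℕ)))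
    (P * vdm l)

/-- The Littlewood–Richardson coefficient `c^C_{A,B}` for partitions of length at most `l`,
as the multiplicity of `s_C` in `s_A * s_B` (this agrees with the structure constants of the
ring of symmetric functions in the Schur basis). -/
noncomputable def lrCoeff (l : ℕ) (A B C : Fin l → ℕ) : ℤ :=
  schurMult l C (schur l A * schur l B)

/-- Dominance: every partial sum of `A` is at least the corresponding partial sum of `B`. -/
def Dom (l : ℕ) (A B : Fin l → ℕ) : Prop :=
  ∀ r : ℕ, ∑ i ∈ Finset.univ.filter (fun i : Fin l => (i : ℕ) < r), B i ≤
    ∑ i ∈ Finset.univ.filter (fun i : Fin l => (i : ℕ) < r), A i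

/-- The Young diagram of `A` (0-based): boxes `(i, j)` with `j < A i`. -/
def YD (l : ℕ) (A : Fin l → ℕ) : Set (Fin l × ℕ) := {p | p.2 < A p.1}

namespace LRProof

/-- `T` is a chain of partitions, each one a horizontal strip over the previous one. -/
def IsChain (T : ℕ → ℕ → ℕ) : Prop :=
  (∀ k r, T k r ≤ T (k+1) r) ∧ ∀ k r, T (k+1) (r+1) ≤ T k r

/-- Excess of letter `i` over letter `i+1` in the rows above `r`. -/
def ex (T : ℕ → ℕ → ℕ) (i r : ℕ) : ℤ :=
  ∑ s ∈ Finset.range r, (2 * (T (i+1) s : ℤ) - T i s - T (i+2) s)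

/-- Lattice word inequality. -/
def EE (T : ℕ → ℕ → ℕ) (i r : ℕ) : ℤ := ex T i r - T (i+2) r + T (i+1) r

def IsLR (T : ℕ → ℕ → ℕ) : Prop := ∀ i r, 0 ≤ EE T i r

/-- Number of letters `i`. -/
def cont (l : ℕ) (T : ℕ → ℕ → ℕ) (i : ℕ) : ℤ :=
  ∑ s ∈ Finset.range l, ((T (i+1) s : ℤ) - T i s)

/-- The first failure of the lattice condition. -/
def IsFirst (T : ℕ → ℕ → ℕ) (i r : ℕ) : Prop :=
  EE T i r < 0 ∧ (∀ i' r', r' < r → 0 ≤ EE T i' r') ∧ ∀ i', i < i' → 0 ≤ EE T i' r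

/-- Partial Bender-Knuth toggle. -/
def toggle (T : ℕ → ℕ → ℕ) (i r : ℕ) : ℕ → ℕ → ℕ := fun k s =>
  if k = i + 1 then
    if s < r then T k s
    else if s = r then
      (max (T i s) (T (i+2) (s+1)) + (T (i+2) s - ex T i r - 1) - T (i+1) s : ℤ).toNat
    else max (T i s) (T (i+2) (s+1)) + min (T (i+2) s) (T i (s-1)) - T (i+1) s
  else T k s

lemma isFirst_unique {T : ℕ → ℕ → ℕ} {i r i' r' : ℕ} (h : IsFirst T i r) (h' : IsFirst T i' r') :
    i = i' ∧ r = r' := by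
  obtain ⟨a, b, c⟩ := h
  obtain ⟨a', b', c'⟩ := h'
  have hr : r = r' := by
    rcases lt_trichotomy r r' with h | h | h
    · have := b' i r h; omega
    · exact h
    · have := b i' r' h; omega
  subst hr
  refine ⟨?_, rfl⟩
  rcases lt_trichotomy i i' with h | h | h
  · have := c i' h; omega
  · exact h
  · have := c' i h; omega

lemma ex_succ (T : ℕ → ℕ → ℕ) (i r : ℕ) :
    ex T i (r+1) = EE T i r + T (i+1) r - T i r := by
  unfold EE ex
  rw [Finset.sum_range_succ]; ring

lemma EE_nonneg_of_ge {T : ℕ → ℕ → ℕ} {l : ℕ} {A : ℕ → ℕ} (hT : IsChain T)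
    (hl : ∀ k, l ≤ k → T k = A) {i : ℕ} (hi : l ≤ i + 1) (r : ℕ) : 0 ≤ EE T i r := by
  unfold EE
  have h1 : T (i+2) = T (i+1) := by rw [hl (i+2) (by omega), hl (i+1) hi]
  have : 0 ≤ ex T i r := by
    unfold ex
    apply Finset.sum_nonneg
    intro s _
    have := hT.1 i s
    rw [h1]; omega
  rw [h1]; omega

lemma exists_isFirst {T : ℕ → ℕ → ℕ} {l : ℕ} {A : ℕ → ℕ} (hT : IsChain T)
    (hl : ∀ k, l ≤ k → T k = A) (h : ¬ IsLR T) : ∃ i r, IsFirst T i r := by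
  classical
  have h1 : ∃ r, ∃ i, EE T i r < 0 := by
    unfold IsLR at h; push Not at h
    obtain ⟨i, r, h⟩ := h; exact ⟨r, i, h⟩
  set r := Nat.find h1 with hr
  have h2 := Nat.find_spec h1
  have h3 : ∀ r' < r, ∀ i, 0 ≤ EE T i r' := fun r' hr' i => by
    have := Nat.find_min h1 hr'
    push Not at this
    exact this i
  obtain ⟨i, hi⟩ := h2
  have hb : ∀ i, EE T i r < 0 → i ≤ l := fun i hi => by
    by_contra hc
    have := EE_nonneg_of_ge hT hl (i := i) (by omega) r
    omega
  refine ⟨Nat.findGreatest (fun i => EE T i r < 0) l, r, ?_, fun i' r' h => h3 r' h i', ?_⟩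
  · exact Nat.findGreatest_spec (P := fun i => EE T i r < 0) (hb i hi) hi
  · intro i' hi'
    by_contra hc
    have := Nat.le_findGreatest (P := fun i => EE T i r < 0) (hb i' (by omega)) (by simpa using hc)
    omega

lemma chain_zero {T : ℕ → ℕ → ℕ} {l : ℕ} {A : ℕ → ℕ} (hT : IsChain T)
    (hl : ∀ k, l ≤ k → T k = A) (hA : ∀ r, l ≤ r → A r = 0) (k r : ℕ) (hr : l ≤ r) :
    T k r = 0 := by
  have h1 : T k r ≤ T (k + l) r :=
    (monotone_nat_of_le_succ (f := fun k => T k r) (fun k => hT.1 k r)) (by omega)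
  rw [hl (k+l) (by omega), hA r hr] at h1
  omega

section
variable {T : ℕ → ℕ → ℕ} {l : ℕ} {A : ℕ → ℕ} {i r : ℕ}

lemma toggle_ne {k : ℕ} (h : k ≠ i + 1) : toggle T i r k = T k := by
  funext s; simp [toggle, h]

lemma toggle_lt {k s : ℕ} (h : s < r) : toggle T i r k s = T k s := by
  simp [toggle, h]

lemma toggle_gt {s : ℕ} (h : r < s) : toggle T i r (i+1) s =
    max (T i s) (T (i+2) (s+1)) + min (T (i+2) s) (T i (s-1)) - T (i+1) s := by
  simp [toggle, show ¬ s < r by omega, show s ≠ r by omega]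

lemma toggle_gt' (hT : IsChain T) {s : ℕ} (h : r < s) : toggle T i r (i+1) s + T (i+1) s =
    max (T i s) (T (i+2) (s+1)) + min (T (i+2) s) (T i (s-1)) := by
  rw [toggle_gt h]
  have h1 := hT.1 i s
  have h2 := hT.2 (i+1) s
  simp only [show i + 1 + 1 = i + 2 from rfl] at *
  have : T (i+1) s ≤ max (T i s) (T (i+2) (s+1)) + min (T (i+2) s) (T i (s-1)) := by
    have h3 := hT.1 (i+1) s
    have h4 := hT.2 i (s-1)
    rw [Nat.sub_add_cancel (by omega)] at h4
    simp only [show i + 1 + 1 = i + 2 from rfl] at *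
    omega
  omega

lemma toggle_eq (hT : IsChain T) (hf : IsFirst T i r) : (toggle T i r (i+1) r : ℤ) + T (i+1) r =
    max (T i r) (T (i+2) (r+1)) + (T (i+2) r - ex T i r - 1) := by
  have h1 := hT.1 i r
  have h2 := hT.2 (i+1) r
  have h3 := hf.1
  unfold EE at h3
  simp only [show i + 1 + 1 = i + 2 from rfl] at *
  simp only [toggle, if_true, lt_irrefl, if_false]
  omega

lemma ex_bound (hT : IsChain T) (hf : IsFirst T i r) : 0 ≤ ex T i r ∧ ∀ s, r = s + 1 → (T (i+2) r : ℤ) - ex T i r ≤ T i s := by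
  rcases r with _ | s
  · simp [ex]
  · have h1 := hf.2.1 i s (by omega)
    have h2 := hT.1 i s
    have h3 := hT.2 (i+1) s
    rw [ex_succ]
    simp only [show i + 1 + 1 = i + 2 from rfl] at *
    refine ⟨by omega, fun s' hs => ?_⟩
    obtain rfl : s = s' := by omega
    omega

/-- bounds on the toggled row -/
lemma toggle_bounds (hT : IsChain T) (hf : IsFirst T i r) (s : ℕ) : T i s ≤ toggle T i r (i+1) s ∧ T (i+2) (s+1) ≤ toggle T i r (i+1) s ∧
    toggle T i r (i+1) s ≤ T (i+2) s ∧ ∀ u, s = u + 1 → toggle T i r (i+1) s ≤ T i u := by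
  have a1 := hT.1 i s
  have a2 := hT.2 (i+1) s
  have a3 := hT.1 (i+1) s
  have a4 : ∀ u, s = u + 1 → T (i+1) s ≤ T i u := by
    rintro u rfl; exact hT.2 i u
  simp only [show i + 1 + 1 = i + 2 from rfl] at *
  rcases lt_trichotomy s r with h | h | h
  · rw [toggle_lt h]
    exact ⟨a1, a2, a3, a4⟩
  · subst h
    have b1 := toggle_eq hT hf
    obtain ⟨b2, b3⟩ := ex_bound hT hf
    have b4 := hf.1
    unfold EE at b4
    refine ⟨by omega, by omega, by omega, fun u hu => ?_⟩
    have := b3 u hu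
    omega
  · have b1 := toggle_gt' hT (i := i) h
    obtain ⟨u, rfl⟩ : ∃ u, s = u + 1 := ⟨s - 1, by omega⟩
    have := a4 u rfl
    simp only [Nat.add_sub_cancel] at b1
    refine ⟨by omega, by omega, by omega, fun u' hu => ?_⟩
    obtain rfl : u = u' := by omega
    omega

lemma toggle_isChain (hT : IsChain T) (hf : IsFirst T i r) : IsChain (toggle T i r) := by
  have hb := toggle_bounds hT hf
  constructor
  · intro k s
    by_cases h1 : k = i + 1
    · subst h1
      rw [toggle_ne (k := i+1+1) (by omega)]
      exact (hb s).2.2.1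
    · rw [toggle_ne h1]
      by_cases h2 : k + 1 = i + 1
      · obtain rfl : k = i := by omega
        exact (hb s).1
      · rw [toggle_ne h2]; exact hT.1 k s
  · intro k s
    by_cases h1 : k = i + 1
    · subst h1
      rw [toggle_ne (k := i+1+1) (by omega)]
      exact (hb s).2.1
    · rw [toggle_ne h1]
      by_cases h2 : k + 1 = i + 1
      · obtain rfl : k = i := by omega
        exact (hb (s+1)).2.2.2 s rfl
      · rw [toggle_ne h2]; exact hT.2 k s

lemma toggle_ex {k s : ℕ} (h : s ≤ r) : ex (toggle T i r) k s = ex T k s := by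
  unfold ex
  apply Finset.sum_congr rfl
  intro u hu
  have : u < r := by simp at hu; omega
  rw [toggle_lt this, toggle_lt this, toggle_lt this]

lemma toggle_isFirst (hT : IsChain T) (hf : IsFirst T i r) : IsFirst (toggle T i r) i r := by
  refine ⟨?_, ?_, ?_⟩
  · unfold EE
    rw [toggle_ex le_rfl, toggle_ne (k := i+2) (by omega)]
    have := toggle_eq hT hf
    have h1 := hT.1 i r
    have h2 := hT.2 (i+1) r
    have h3 := hf.1
    unfold EE at h3
    simp only [show i + 1 + 1 = i + 2 from rfl] at *
    have h4 := hT.1 i r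
    have : (max (T i r) (T (i+2) (r+1)) : ℤ) ≤ T (i+1) r := by omega
    omega
  · intro i' r' h
    have := hf.2.1 i' r' h
    unfold EE at *
    rwa [toggle_ex h.le, toggle_lt h, toggle_lt h]
  · intro i' h
    have := hf.2.2 i' h
    unfold EE at *
    rwa [toggle_ex le_rfl, toggle_ne (by omega), toggle_ne (by omega)]

lemma toggle_toggle (hT : IsChain T) (hf : IsFirst T i r) : toggle (toggle T i r) i r = T := by
  have hT' := toggle_isChain hT hf
  have hf' := toggle_isFirst hT hf
  funext k s
  by_cases h1 : k = i + 1
  · subst h1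
    rcases lt_trichotomy s r with h | h | h
    · rw [toggle_lt h, toggle_lt h]
    · subst h
      have b1 := toggle_eq hT hf
      have b2 := toggle_eq hT' hf'
      rw [toggle_ex le_rfl, toggle_ne (k := i) (by omega), toggle_ne (k := i+2) (by omega)] at b2
      omega
    · have b1 := toggle_gt' hT (i := i) h
      have b2 := toggle_gt' hT' (i := i) h
      rw [toggle_ne (k := i) (by omega), toggle_ne (k := i+2) (by omega)] at b2
      omega
  · rw [toggle_ne h1, toggle_ne h1]

lemma first_lt (hT : IsChain T) (hl : ∀ k, l ≤ k → T k = A) (hA : ∀ r, l ≤ r → A r = 0) (hf : IsFirst T i r) : i + 1 < l ∧ r < l := by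
  constructor
  · by_contra h
    have := EE_nonneg_of_ge hT hl (i := i) (by omega) r
    have := hf.1
    omega
  · by_contra h
    have h1 := hf.1
    have z1 := chain_zero hT hl hA (i+2) r (by omega)
    unfold EE at h1
    have := (ex_bound hT hf).1
    omega

lemma toggle_sum_aux (hT : IsChain T) (hf : IsFirst T i r) (d : ℕ) :
    ∑ s ∈ Finset.range (r + 1 + d), ((toggle T i r (i+1) s : ℤ) + T (i+1) s) =
    ∑ s ∈ Finset.range (r + 1 + d), ((T i s : ℤ) + T (i+2) s) - 1 +
      (max (T i (r+d)) (T (i+2) (r+d+1)) - T i (r+d)) := by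
  induction d with
  | zero =>
    rw [add_zero, Finset.sum_range_succ, Finset.sum_range_succ, toggle_eq hT hf]
    have : ∑ s ∈ Finset.range r, ((toggle T i r (i+1) s : ℤ) + T (i+1) s) =
        ex T i r + ∑ s ∈ Finset.range r, ((T i s : ℤ) + T (i+2) s) := by
      unfold ex
      rw [← Finset.sum_add_distrib]
      apply Finset.sum_congr rfl
      intro u hu
      rw [toggle_lt (by simpa using hu)]
      ring
    rw [this]
    simp only [add_zero]
    ring
  | succ d ih =>
    rw [← add_assoc, Finset.sum_range_succ, Finset.sum_range_succ, ih]
    have := toggle_gt' hT (i := i) (r := r) (s := r + 1 + d) (by omega)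
    simp only [show r + 1 + d - 1 = r + d by omega] at this
    simp only [show r + (d + 1) = r + 1 + d by omega, show r + d + 1 = r + 1 + d by omega]
    omega

lemma toggle_sum (hT : IsChain T) (hl : ∀ k, l ≤ k → T k = A) (hA : ∀ r, l ≤ r → A r = 0) (hf : IsFirst T i r) :
    ∑ s ∈ Finset.range l, ((toggle T i r (i+1) s : ℤ) + T (i+1) s) =
    ∑ s ∈ Finset.range l, ((T i s : ℤ) + T (i+2) s) - 1 := by
  have h := (first_lt hT hl hA hf).2
  have h2 := toggle_sum_aux hT hf (l - (r+1))
  have z1 := chain_zero hT hl hA (i+2) l le_rfl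
  rw [show r + 1 + (l - (r+1)) = l by omega, show r + (l - (r+1)) + 1 = l by omega, z1] at h2
  rw [h2]
  simp

lemma toggle_cont (hT : IsChain T) (hl : ∀ k, l ≤ k → T k = A) (hA : ∀ r, l ≤ r → A r = 0) (hf : IsFirst T i r) (k : ℕ) : cont l (toggle T i r) k - k =
    cont l T (Equiv.swap i (i+1) k) - (Equiv.swap i (i+1) k : ℕ) := by
  have h := toggle_sum hT hl hA hf
  by_cases h1 : k = i
  · subst h1
    rw [Equiv.swap_apply_left]
    unfold cont
    rw [toggle_ne (k := k) (by omega)]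
    simp only [Finset.sum_add_distrib, Finset.sum_sub_distrib, add_assoc, Nat.reduceAdd] at *
    push_cast
    linarith
  by_cases h2 : k = i + 1
  · subst h2
    rw [Equiv.swap_apply_right]
    unfold cont
    rw [toggle_ne (k := i+1+1) (by omega)]
    simp only [Finset.sum_add_distrib, Finset.sum_sub_distrib, add_assoc, Nat.reduceAdd] at *
    push_cast
    linarith
  · rw [Equiv.swap_apply_of_ne_of_ne h1 h2]
    unfold cont
    rw [toggle_ne (k := k) (by omega), toggle_ne (k := k+1) (by omega)]

end


/-- Extension of a tuple by zero. -/
def ext0 (l : ℕ) (A : Fin l → ℕ) : ℕ → ℕ := fun r => if h : r < l then A ⟨r, h⟩ else 0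

/-- Partitions `D` such that `A / D` is a horizontal strip. -/
def HS (l : ℕ) (A : ℕ → ℕ) : Finset (ℕ → ℕ) :=
  (Fintype.piFinset fun i : Fin l => Finset.Icc (A (i + 1)) (A i)).map
    ⟨ext0 l, fun a b h => by
      funext i
      have := congrFun h i
      simpa [ext0] using this⟩

/-- `A` is a partition with at most `l` parts. -/
def IsPart (l : ℕ) (A : ℕ → ℕ) : Prop := Antitone A ∧ ∀ r, l ≤ r → A r = 0

lemma mem_HS {l : ℕ} {A D : ℕ → ℕ} (hA : IsPart l A) :
    D ∈ HS l A ↔ ∀ r, A (r+1) ≤ D r ∧ D r ≤ A r := by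
  unfold HS
  simp only [Finset.mem_map, Fintype.mem_piFinset, Finset.mem_Icc]
  constructor
  · rintro ⟨a, ha, rfl⟩ r
    change A (r+1) ≤ ext0 l a r ∧ ext0 l a r ≤ A r
    unfold ext0
    split_ifs with h
    · exact ha ⟨r, h⟩
    · have h1 := hA.2 r (by omega)
      have h2 := hA.2 (r+1) (by omega)
      omega
  · intro h
    refine ⟨fun i => D i, fun i => h i, ?_⟩
    funext r
    change ext0 l (fun i : Fin l => D i) r = D r
    unfold ext0
    split_ifs with h'
    · rfl
    · have h1 := hA.2 r (by omega)
      have := h r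
      omega

lemma isPart_HS {l : ℕ} {A D : ℕ → ℕ} (hA : IsPart l A) (hD : D ∈ HS l A) : IsPart l D := by
  rw [mem_HS hA] at hD
  refine ⟨antitone_nat_of_succ_le fun r => (hD (r+1)).2.trans (hD r).1, fun r hr => ?_⟩
  have := hA.2 r hr
  have := hD r
  omega

/-- Chains of length `m` ending in `A`. -/
noncomputable def chains (l : ℕ) : ℕ → (ℕ → ℕ) → Finset (ℕ → ℕ → ℕ)
  | 0, A => {fun _ => A}
  | m+1, A => by
    classical
    exact (HS l A).biUnion fun D => (chains l m D).image (fun T k => if k ≤ m then T k else A)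

lemma mem_chains {l m : ℕ} {A : ℕ → ℕ} (hA : IsPart l A) (T : ℕ → ℕ → ℕ) :
    T ∈ chains l m A ↔ IsChain T ∧ ∀ k, m ≤ k → T k = A := by
  induction m generalizing A T with
  | zero =>
    simp only [chains, Finset.mem_singleton]
    constructor
    · rintro rfl
      exact ⟨⟨fun k r => le_rfl, fun k r => hA.1 (by omega)⟩, fun _ _ => rfl⟩
    · rintro ⟨_, h⟩
      funext k
      exact h k (by omega)
  | succ m ih =>
    simp only [chains, Finset.mem_biUnion, Finset.mem_image]
    constructor
    · rintro ⟨D, hD, T, hT, rfl⟩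
      rw [ih (isPart_HS hA hD)] at hT
      rw [mem_HS hA] at hD
      obtain ⟨⟨h1, h2⟩, h3⟩ := hT
      have h4 := h3 m le_rfl
      refine ⟨⟨fun k r => ?_, fun k r => ?_⟩, fun k hk => if_neg (by omega)⟩
      · dsimp only
        by_cases c1 : k + 1 ≤ m
        · rw [if_pos c1, if_pos (by omega)]; exact h1 k r
        · rw [if_neg c1]
          split_ifs with c2
          · obtain rfl : k = m := by omega
            rw [h4]; exact (hD r).2
          · exact le_rfl
      · dsimp only
        by_cases c1 : k + 1 ≤ m
        · rw [if_pos c1, if_pos (by omega)]; exact h2 k r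
        · rw [if_neg c1]
          split_ifs with c2
          · obtain rfl : k = m := by omega
            rw [h4]; exact (hD r).1
          · exact hA.1 (by omega)
    · rintro ⟨⟨h1, h2⟩, h3⟩
      have h4 := h3 (m+1) le_rfl
      have hD : T m ∈ HS l A := by
        rw [mem_HS hA]
        intro r
        rw [← h4]
        exact ⟨h2 m r, h1 m r⟩
      refine ⟨T m, hD, fun k => T (min k m), ?_, ?_⟩
      · rw [ih (isPart_HS hA hD)]
        refine ⟨⟨fun k r => ?_, fun k r => ?_⟩, fun k hk => by rw [min_eq_right hk]⟩
        · dsimp only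
          rcases lt_or_ge k m with c | c
          · rw [min_eq_left c.le, min_eq_left (by omega : k + 1 ≤ m)]; exact h1 k r
          · rw [min_eq_right c, min_eq_right (by omega : m ≤ k + 1)]
        · dsimp only
          rcases lt_or_ge k m with c | c
          · rw [min_eq_left c.le, min_eq_left (by omega : k + 1 ≤ m)]; exact h2 k r
          · rw [min_eq_right c, min_eq_right (by omega : m ≤ k + 1)]
            exact (isPart_HS hA hD).1 (by omega)
      · funext k
        dsimp only
        split_ifs with c
        · rw [min_eq_left c]
        · exact (h3 k (by omega)).symm

lemma cont_antitone_of_LR {T : ℕ → ℕ → ℕ} {l : ℕ} {A : ℕ → ℕ} (hT : IsChain T)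
    (hl : ∀ k, l ≤ k → T k = A) (hA : ∀ r, l ≤ r → A r = 0) (h : IsLR T) (i : ℕ) :
    cont l T (i+1) ≤ cont l T i := by
  have h1 := h i l
  unfold EE at h1
  rw [chain_zero hT hl hA _ l le_rfl, chain_zero hT hl hA _ l le_rfl] at h1
  have : ex T i l = cont l T i - cont l T (i+1) := by
    unfold ex cont
    rw [← Finset.sum_sub_distrib]
    apply Finset.sum_congr rfl
    intro s _
    simp only [add_assoc, Nat.reduceAdd]
    ring
  simp only [Nat.cast_zero] at h1
  omega

lemma perm_eq_one_of_strictMono {l : ℕ} (σ : Equiv.Perm (Fin l)) (h : StrictMono σ) : σ = 1 := by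
  ext i
  have : (h.orderIsoOfSurjective σ σ.surjective) = OrderIso.refl _ := Subsingleton.elim _ _
  have := congrArg (fun e => e i) this
  simpa using congrArg Fin.val this

lemma swap_val {l i : ℕ} (h : i + 1 < l) (k : Fin l) :
    ((Equiv.swap (⟨i, by omega⟩ : Fin l) ⟨i+1, h⟩ k : Fin l) : ℕ) = Equiv.swap i (i+1) (k : ℕ) := by
  simp only [Equiv.swap_apply_def, Fin.ext_iff]
  split_ifs <;> rfl

/-- The sign-reversing involution. -/
lemma cancel {l : ℕ} {A : ℕ → ℕ} (hA : IsPart l A) {B : Fin l → ℕ} (hB : Antitone B)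
    (f : (ℕ → ℕ) → ℤ) [DecidablePred IsLR] :
    ∑ σ : Equiv.Perm (Fin l), (Equiv.Perm.sign σ : ℤ) *
      ∑ T ∈ (chains l l A).filter (fun T => ∀ i : Fin l, cont l T i = B (σ i) - (σ i : ℕ) + (i : ℕ)),
        f (T 0) =
    ∑ T ∈ (chains l l A).filter (fun T => IsLR T ∧ ∀ i : Fin l, cont l T i = B i), f (T 0) := by
  classical
  simp only [Finset.mul_sum]
  rw [Finset.sum_sigma']
  rw [← Finset.sum_filter_add_sum_filter_not _ (fun x => IsLR x.2)]
  have hbad : ∑ x ∈ (Finset.univ.sigma fun σ : Equiv.Perm (Fin l) => (chains l l A).filter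
      (fun T => ∀ i : Fin l, cont l T i = B (σ i) - (σ i : ℕ) + (i : ℕ))).filter
      (fun x => ¬ IsLR x.2), (Equiv.Perm.sign x.1 : ℤ) * f (x.2 0) = 0 := by
    have key : ∀ x ∈ (Finset.univ.sigma fun σ : Equiv.Perm (Fin l) => (chains l l A).filter
      (fun T => ∀ i : Fin l, cont l T i = B (σ i) - (σ i : ℕ) + (i : ℕ))).filter
      (fun x => ¬ IsLR x.2), ∃ p : ℕ × ℕ, IsFirst x.2 p.1 p.2 ∧ p.1 + 1 < l := by
      intro x hx
      simp only [Finset.mem_filter, Finset.mem_sigma, mem_chains hA] at hx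
      obtain ⟨i, r, h⟩ := exists_isFirst hx.1.2.1.1 hx.1.2.1.2 hx.2
      exact ⟨(i, r), h, (first_lt hx.1.2.1.1 hx.1.2.1.2 hA.2 h).1⟩
    choose! p hp hp' using key
    have hmem : ∀ x (hx : x ∈ (Finset.univ.sigma fun σ : Equiv.Perm (Fin l) => (chains l l A).filter
      (fun T => ∀ i : Fin l, cont l T i = B (σ i) - (σ i : ℕ) + (i : ℕ))).filter
      (fun x => ¬ IsLR x.2)),
      (⟨x.1 * Equiv.swap ⟨(p x).1, by have := hp' x hx; omega⟩
      ⟨(p x).1 + 1, hp' x hx⟩, toggle x.2 (p x).1 (p x).2⟩ :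
        (_ : Equiv.Perm (Fin l)) × (ℕ → ℕ → ℕ)) ∈
      (Finset.univ.sigma fun σ : Equiv.Perm (Fin l) => (chains l l A).filter
      (fun T => ∀ i : Fin l, cont l T i = B (σ i) - (σ i : ℕ) + (i : ℕ))).filter
      (fun x => ¬ IsLR x.2) := by
      intro x hx
      have h1 := hp x hx
      have h2 := hp' x hx
      simp only [Finset.mem_filter, Finset.mem_sigma, mem_chains hA, Finset.mem_univ, true_and] at hx ⊢
      obtain ⟨⟨⟨hc, hl⟩, hn⟩, hLR⟩ := hx
      refine ⟨⟨⟨toggle_isChain hc h1, fun k hk => ?_⟩, fun k => ?_⟩, fun h => ?_⟩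
      · rw [toggle_ne (by omega), hl k hk]
      · have h3 := toggle_cont hc hl hA.2 h1 (k : ℕ)
        rw [← swap_val h2 k, hn] at h3
        rw [Equiv.Perm.mul_apply]
        linarith
      · have := h (p x).1 (p x).2
        have := (toggle_isFirst hc h1).1
        omega
    refine Finset.sum_involution (fun x hx => ⟨x.1 * Equiv.swap ⟨(p x).1, by have := hp' x hx; omega⟩
      ⟨(p x).1 + 1, hp' x hx⟩, toggle x.2 (p x).1 (p x).2⟩) ?_ ?_ hmem ?_
    · intro x hx
      dsimp only
      rw [toggle_ne (by omega), Equiv.Perm.sign_mul, Equiv.Perm.sign_swap (by simp [Fin.ext_iff])]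
      simp
    · intro x hx _ h
      have h1 := congrArg (fun y => Equiv.Perm.sign y.1) h
      dsimp only at h1
      rw [Equiv.Perm.sign_mul, Equiv.Perm.sign_swap (by simp [Fin.ext_iff])] at h1
      simp at h1
    · intro x hx
      have h1 := hp x hx
      have h2 := hp _ (hmem x hx)
      simp only [Finset.mem_filter, Finset.mem_sigma, mem_chains hA, Finset.mem_univ, true_and] at hx
      obtain ⟨⟨⟨hc, hl⟩, hn⟩, hLR⟩ := hx
      have h5 := Prod.ext_iff.2 (isFirst_unique h2 (toggle_isFirst hc h1))
      simp only [h5, toggle_toggle hc h1, mul_assoc, Equiv.swap_mul_self, mul_one]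
  rw [hbad, add_zero]
  symm
  refine Finset.sum_bij (fun T _ => ⟨1, T⟩) ?_ ?_ ?_ ?_
  · intro T hT
    simp only [Finset.mem_filter, Finset.mem_sigma, Finset.mem_univ, true_and] at hT ⊢
    refine ⟨⟨hT.1, fun i => ?_⟩, hT.2.1⟩
    rw [hT.2.2 i]; simp
  · intro T _ T' _ h
    simpa using h
  · rintro ⟨σ, T⟩ hx
    simp only [Finset.mem_filter, Finset.mem_sigma, Finset.mem_univ, true_and] at hx
    obtain ⟨⟨hT, hn⟩, hLR⟩ := hx
    have hm := hT
    rw [mem_chains hA] at hm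
    have hcont : Antitone (cont l T) := antitone_nat_of_succ_le
      (cont_antitone_of_LR hm.1 hm.2 hA.2 hLR)
    have hσ : σ = 1 := by
      apply perm_eq_one_of_strictMono
      intro i j hij
      by_contra hc
      push Not at hc
      have h1 := hcont (show (i:ℕ) ≤ j from hij.le)
      rw [hn, hn] at h1
      have h2 := hB hc
      have h3 : (σ j : ℕ) ≤ σ i := hc
      have h4 : (i : ℕ) < j := hij
      omega
    subst hσ
    refine ⟨T, ?_, rfl⟩
    simp only [Finset.mem_filter]
    exact ⟨hT, hLR, fun i => by rw [hn i]; simp⟩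
  · intro T _
    simp


/-- Tuples as exponents. -/
noncomputable def vv {l : ℕ} (g : Fin l → ℕ) : Fin l →₀ ℕ := Finsupp.equivFunOnFinite.symm g

@[simp] lemma vv_apply {l : ℕ} (g : Fin l → ℕ) (i : Fin l) : vv g i = g i := rfl

/-- Alternating polynomials. -/
def Alt {l : ℕ} (P : MvPolynomial (Fin l) ℤ) : Prop :=
  ∀ i j : Fin l, i ≠ j → rename (Equiv.swap i j) P = -P

lemma alt_coeff {l : ℕ} {P : MvPolynomial (Fin l) ℤ} (hP : Alt P) {i j : Fin l} (hij : i ≠ j)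
    (g : Fin l → ℕ) : coeff (vv (fun k => g (Equiv.swap i j k))) P = - coeff (vv g) P := by
  have h1 := coeff_rename_mapDomain (Equiv.swap i j) (Equiv.swap i j).injective P (vv g)
  rw [hP i j hij, coeff_neg] at h1
  have h2 : Finsupp.mapDomain (Equiv.swap i j) (vv g) = vv (fun k => g (Equiv.swap i j k)) := by
    ext k
    rw [Finsupp.mapDomain_equiv_apply]
    simp
  rw [h2] at h1
  omega

lemma alt_hp_mul {l : ℕ} {P : MvPolynomial (Fin l) ℤ} (hP : Alt P) (k : ℤ) : Alt (hp l k * P) := by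
  intro i j hij
  rw [map_mul, hP i j hij]
  unfold hp
  split_ifs
  · rw [rename_hsymm]; ring
  · simp

lemma alt_add {l : ℕ} {P Q : MvPolynomial (Fin l) ℤ} (hP : Alt P) (hQ : Alt Q) : Alt (P + Q) := by
  intro i j hij
  rw [map_add, hP i j hij, hQ i j hij]; ring

lemma alt_prod_mul {l : ℕ} {P : MvPolynomial (Fin l) ℤ} (hP : Alt P) (n : ℕ → ℤ) (m : ℕ) :
    Alt ((∏ i ∈ Finset.range m, hp l (n i)) * P) := by
  induction m with
  | zero => simpa using hP
  | succ m ih =>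
    rw [Finset.prod_range_succ, mul_comm (∏ i ∈ _, _), mul_assoc]
    exact alt_hp_mul ih _

lemma rename_hp {l : ℕ} (k : ℤ) (e : Equiv.Perm (Fin l)) : rename e (hp l k) = hp l k := by
  unfold hp
  split_ifs
  · rw [rename_hsymm]
  · simp

lemma alt_schur_mul {l : ℕ} {P : MvPolynomial (Fin l) ℤ} (hP : Alt P) (B : Fin l → ℕ) :
    Alt (schur l B * P) := by
  intro i j hij
  rw [map_mul, hP i j hij]
  have : rename (Equiv.swap i j) (schur l B) = schur l B := by
    unfold schur
    rw [AlgHom.map_det]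
    congr 1
    ext1 a b
    simp [rename_hp]
  rw [this]; ring

lemma alt_vdm (l : ℕ) : Alt (vdm l) := by
  intro i j hij
  unfold vdm
  rw [AlgHom.map_det]
  have := Matrix.det_permute (Equiv.swap i j)
    (Matrix.of fun i j : Fin l => (X i : MvPolynomial (Fin l) ℤ) ^ (l - 1 - (j : ℕ)))
  rw [Equiv.Perm.sign_swap hij] at this
  simp only [Units.val_neg, Units.val_one, Int.cast_neg, Int.cast_one, neg_mul, one_mul] at this
  rw [← this]
  congr 1
  ext1 a b
  simp

lemma prod_X_multiset {l : ℕ} (s : Multiset (Fin l)) :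
    (s.map (X : Fin l → MvPolynomial (Fin l) ℤ)).prod = monomial (Multiset.toFinsupp s) 1 := by
  induction s using Multiset.induction_on with
  | empty => simp
  | cons a s ih =>
    rw [Multiset.map_cons, Multiset.prod_cons, ih, ← Multiset.singleton_add, Multiset.toFinsupp_add,
      Multiset.toFinsupp_singleton, X, monomial_mul, one_mul]

lemma coeff_hsymm {l : ℕ} (n : ℕ) (d : Fin l →₀ ℕ) :
    coeff d (hsymm (Fin l) ℤ n) = if ∑ i, d i = n then 1 else 0 := by
  classical
  have h0 : hsymm (Fin l) ℤ n = ∑ s : Sym (Fin l) n,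
      monomial (Multiset.toFinsupp (s : Multiset (Fin l))) 1 :=
    Finset.sum_congr rfl fun s _ => prod_X_multiset _
  rw [h0, coeff_sum]
  simp only [coeff_monomial]
  split_ifs with h
  · refine (Finset.sum_eq_single (Sym.mk (Finsupp.toMultiset d) (by
      rw [Finsupp.card_toMultiset, Finsupp.sum_fintype _ _ (by simp)]; exact h)) ?_ ?_).trans ?_
    · intro b _ hb
      rw [if_neg]
      intro hc
      apply hb
      apply Sym.coe_injective
      change (b : Multiset (Fin l)) = Finsupp.toMultiset d
      rw [← hc]; simp
    · simp
    · simp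
  · apply Finset.sum_eq_zero
    intro s _
    rw [if_neg]
    rintro rfl
    apply h
    have := s.2
    rw [← Multiset.toFinsupp_sum_eq, Finsupp.sum_fintype _ _ (by simp)] at this
    exact this

lemma coeff_hp {l : ℕ} (k : ℤ) (d : Fin l →₀ ℕ) :
    coeff d (hp l k) = if (∑ i, (d i : ℤ)) = k then 1 else 0 := by
  unfold hp
  have h0 : 0 ≤ ∑ i, (d i : ℤ) := Finset.sum_nonneg fun i _ => by positivity
  split_ifs with h1 h2 h2
  · rw [coeff_hsymm, if_pos]
    zify; rw [h2]; omega
  · rw [coeff_hsymm, if_neg]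
    zify; rwa [Int.toNat_of_nonneg h1]
  · omega
  · simp

/-- Coefficient of `x ^ (A + δ)`. -/
noncomputable def cf (l : ℕ) (A : ℕ → ℕ) (P : MvPolynomial (Fin l) ℤ) : ℤ :=
  coeff (vv fun i : Fin l => A i + (l - 1 - (i : ℕ))) P

lemma coeff_hp_mul {l : ℕ} (α : Fin l → ℕ) (k : ℤ) (P : MvPolynomial (Fin l) ℤ) :
    coeff (vv α) (hp l k * P) =
    ∑ β ∈ (Fintype.piFinset fun i : Fin l => Finset.range (α i + 1)).filter
      (fun β => ∑ i, ((α i : ℤ) - β i) = k), coeff (vv β) P := by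
  classical
  rw [coeff_mul, Finset.sum_filter]
  refine Finset.sum_bij' (fun p _ => (p.2 : Fin l → ℕ)) (fun β _ => (vv (α - β), vv β)) ?_ ?_ ?_ ?_ ?_
  · intro p hp
    rw [HasAntidiagonal.mem_antidiagonal] at hp
    simp only [Fintype.mem_piFinset, Finset.mem_range]
    intro i
    have := DFunLike.congr_fun hp i
    simp at this
    omega
  · intro β hβ
    simp only [Fintype.mem_piFinset, Finset.mem_range] at hβ
    rw [HasAntidiagonal.mem_antidiagonal]
    ext i
    have := hβ i
    simp; omega
  · intro p hp
    rw [HasAntidiagonal.mem_antidiagonal] at hp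
    refine Prod.ext ?_ ?_
    · ext i
      have := DFunLike.congr_fun hp i
      simp at this ⊢
      omega
    · ext i; simp
  · intro β hβ
    funext i; simp
  · intro p hp
    rw [HasAntidiagonal.mem_antidiagonal] at hp
    have h1 : vv (p.2 : Fin l → ℕ) = p.2 := by ext; simp
    have h2 : ∑ i, ((α i : ℤ) - p.2 i) = ∑ i, (p.1 i : ℤ) := by
      apply Finset.sum_congr rfl
      intro i _
      have := DFunLike.congr_fun hp i
      simp at this
      omega
    rw [coeff_hp, h1, h2]
    split_ifs <;> simp

/-- Pieri rule in coefficient form. -/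
lemma pieri {l : ℕ} {A : ℕ → ℕ} (hA : IsPart l A) (k : ℤ) {P : MvPolynomial (Fin l) ℤ} (hP : Alt P) :
    cf l A (hp l k * P) =
    ∑ D ∈ (HS l A).filter (fun D => ∑ s ∈ Finset.range l, ((A s : ℤ) - D s) = k), cf l D P := by
  classical
  unfold cf
  obtain ⟨α, hα⟩ : ∃ α : Fin l → ℕ, α = fun i : Fin l => A i + (l - 1 - (i : ℕ)) := ⟨_, rfl⟩
  rw [← hα, coeff_hp_mul]
  have hα' : ∀ j (h : j < l), α ⟨j, h⟩ = A j + (l - 1 - j) := fun _ _ => by rw [hα]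
  have hα'' : ∀ i : Fin l, α i = A i + (l - 1 - (i : ℕ)) := fun _ => by rw [hα]
  rw [← Finset.sum_filter_add_sum_filter_not _
    (fun β : Fin l → ℕ => ∃ j, ∃ h : j + 1 < l, β ⟨j, by omega⟩ ≤ α ⟨j+1, h⟩)]
  have hbad : ∑ β ∈ ((Fintype.piFinset fun i : Fin l => Finset.range (α i + 1)).filter
      (fun β => ∑ i, ((α i : ℤ) - β i) = k)).filter
      (fun β : Fin l → ℕ => ∃ j, ∃ h : j + 1 < l, β ⟨j, by omega⟩ ≤ α ⟨j+1, h⟩),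
      coeff (vv β) P = 0 := by
    have key : ∀ β : Fin l → ℕ, (∃ j, ∃ h : j + 1 < l, β ⟨j, by omega⟩ ≤ α ⟨j+1, h⟩) →
        ∃ j, (∃ h : j + 1 < l, β ⟨j, by omega⟩ ≤ α ⟨j+1, h⟩) ∧
          ∀ j' < j, ∀ h : j' + 1 < l, α ⟨j'+1, h⟩ < β ⟨j', by omega⟩ := by
      intro β h
      refine ⟨Nat.find h, Nat.find_spec h, fun j' hj' h' => ?_⟩
      have := Nat.find_min h hj'
      push Not at this
      exact this h'
    choose! p hp hp' using key
    have hpl : ∀ β ∈ ((Fintype.piFinset fun i : Fin l => Finset.range (α i + 1)).filter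
      (fun β => ∑ i, ((α i : ℤ) - β i) = k)).filter
      (fun β : Fin l → ℕ => ∃ j, ∃ h : j + 1 < l, β ⟨j, by omega⟩ ≤ α ⟨j+1, h⟩), p β + 1 < l := by
      intro β h
      exact (hp β (Finset.mem_filter.1 h).2).1
    have hmem : ∀ β (h : β ∈ ((Fintype.piFinset fun i : Fin l => Finset.range (α i + 1)).filter
      (fun β => ∑ i, ((α i : ℤ) - β i) = k)).filter
      (fun β : Fin l → ℕ => ∃ j, ∃ h : j + 1 < l, β ⟨j, by omega⟩ ≤ α ⟨j+1, h⟩)),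
      (fun i => β (Equiv.swap ⟨p β, by have := hpl β h; omega⟩ ⟨p β + 1, hpl β h⟩ i)) ∈
      ((Fintype.piFinset fun i : Fin l => Finset.range (α i + 1)).filter
      (fun β => ∑ i, ((α i : ℤ) - β i) = k)).filter
      (fun β : Fin l → ℕ => ∃ j, ∃ h : j + 1 < l, β ⟨j, by omega⟩ ≤ α ⟨j+1, h⟩) := by
      intro β h
      have hl := hpl β h
      simp only [Finset.mem_filter, Fintype.mem_piFinset, Finset.mem_range] at h ⊢
      obtain ⟨⟨h1, h2⟩, h3⟩ := h
      obtain ⟨_, h4⟩ := hp β h3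
      have h5 := h1 ⟨p β + 1, hl⟩
      have h6 : α ⟨p β + 1, hl⟩ ≤ α ⟨p β, by omega⟩ := by
        simp only [hα', hα'']
        have := hA.1 (show p β ≤ p β + 1 by omega)
        omega
      refine ⟨⟨fun i => ?_, ?_⟩, p β, hl, ?_⟩
      · by_cases c1 : i = ⟨p β, by omega⟩
        · rw [c1, Equiv.swap_apply_left]; omega
        by_cases c2 : i = ⟨p β + 1, hl⟩
        · rw [c2, Equiv.swap_apply_right]; omega
        rw [Equiv.swap_apply_of_ne_of_ne c1 c2]
        exact h1 i
      · rw [← h2, Finset.sum_sub_distrib, Finset.sum_sub_distrib]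
        congr 1
        exact Equiv.sum_comp (Equiv.swap _ _) (fun i => (β i : ℤ))
      · rw [Equiv.swap_apply_left]; omega
    have hne : ∀ j (h : j + 1 < l), (⟨j, by omega⟩ : Fin l) ≠ ⟨j+1, h⟩ := by
      intro j h; simp [Fin.ext_iff]
    refine Finset.sum_involution (fun β h =>
      (fun i => β (Equiv.swap ⟨p β, by have := hpl β h; omega⟩ ⟨p β + 1, hpl β h⟩ i))) ?_ ?_ hmem ?_
    · intro β h
      rw [alt_coeff hP (hne _ (hpl β h))]; ring
    · intro β h h0 hc
      apply h0
      have := alt_coeff hP (hne _ (hpl β h)) β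
      rw [hc] at this
      omega
    · intro β h
      have m' := hmem β h
      have hl := hpl β h
      have hl' := hpl _ m'
      have q := hp β (Finset.mem_filter.1 h).2
      have q' := hp (fun i => β (Equiv.swap ⟨p β, by omega⟩ ⟨p β + 1, hl⟩ i)) (Finset.mem_filter.1 m').2
      have r := hp' β (Finset.mem_filter.1 h).2
      have r' := hp' (fun i => β (Equiv.swap ⟨p β, by omega⟩ ⟨p β + 1, hl⟩ i)) (Finset.mem_filter.1 m').2
      have hpe : p (fun i => β (Equiv.swap ⟨p β, by omega⟩ ⟨p β + 1, hl⟩ i)) = p β := by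
        suffices aux : ∀ p', (∃ h : p' + 1 < l, β (Equiv.swap ⟨p β, by omega⟩ ⟨p β + 1, hl⟩ ⟨p', by omega⟩)
            ≤ α ⟨p' + 1, h⟩) → (∀ j' < p', ∀ h : j' + 1 < l, α ⟨j' + 1, h⟩ <
              β (Equiv.swap ⟨p β, by omega⟩ ⟨p β + 1, hl⟩ ⟨j', by omega⟩)) → p' = p β from aux _ q' r'
        intro p' q' r'
        have h1 := Fintype.mem_piFinset.1 (Finset.mem_filter.1 (Finset.mem_filter.1 h).1).1
          ⟨p β + 1, hl⟩
        rw [Finset.mem_range] at h1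
        rcases lt_trichotomy p' (p β) with c | c | c
        · have h2 := q'.2
          have h3 := r p' c q'.1
          rw [Equiv.swap_apply_of_ne_of_ne (by simp [Fin.ext_iff]; omega)
            (by simp [Fin.ext_iff]; omega)] at h2
          omega
        · exact c
        · have h2 := r' (p β) c hl
          rw [Equiv.swap_apply_left] at h2
          omega
      funext i
      simp only [hpe, Equiv.swap_apply_self]
  rw [hbad, zero_add]
  symm
  have hα1 : ∀ j, ∀ h : j + 1 < l, l - 1 - j ≤ α ⟨j+1, h⟩ + 1 := by
    intro j h; simp only [hα', hα'']; omega
  refine Finset.sum_bij' (fun D _ => fun i : Fin l => D i + (l - 1 - (i : ℕ)))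
    (fun β _ => ext0 l (fun i => β i - (l - 1 - (i : ℕ)))) ?_ ?_ ?_ ?_ ?_
  · intro D hD
    simp only [Finset.mem_filter, mem_HS hA] at hD
    simp only [Finset.mem_filter, Fintype.mem_piFinset, Finset.mem_range]
    refine ⟨⟨fun i => ?_, ?_⟩, ?_⟩
    · have := hD.1 i
      simp only [hα', hα'']; omega
    · rw [← hD.2, Finset.sum_range]
      apply Finset.sum_congr rfl
      intro i _
      simp only [hα', hα'']; push_cast; ring
    · push Not
      intro j h
      have := hD.1 j
      simp only [hα', hα'']; omega
  · intro β hβ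
    simp only [Finset.mem_filter, Fintype.mem_piFinset, Finset.mem_range] at hβ
    obtain ⟨⟨h1, h2⟩, h3⟩ := hβ
    push Not at h3
    have hge : ∀ i : Fin l, A (i+1) + (l - 1 - (i:ℕ)) ≤ β i := by
      intro i
      by_cases c : (i : ℕ) + 1 < l
      · have := h3 i c
        simp only [hα', hα''] at this
        change A (i + 1) + _ < β i at this
        omega
      · have := hA.2 (i+1) (by omega)
        omega
    simp only [Finset.mem_filter, mem_HS hA]
    constructor
    · intro r
      unfold ext0
      dsimp only
      split_ifs with c
      · have a1 := hge ⟨r, c⟩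
        have a2 := h1 ⟨r, c⟩
        simp only [hα', hα''] at a1 a2
        omega
      · have := hA.2 (r+1) (by omega)
        omega
    · rw [← h2, Finset.sum_range]
      apply Finset.sum_congr rfl
      intro i _
      have a1 := hge i
      simp only [hα', hα'', ext0, Fin.is_lt, dif_pos, Fin.eta]
      omega
  · intro D hD
    simp only [Finset.mem_filter, mem_HS hA] at hD
    funext r
    unfold ext0
    split_ifs with c
    · simp
    · have := hD.1 r
      have := hA.2 r (by omega)
      omega
  · intro β hβ
    simp only [Finset.mem_filter, Fintype.mem_piFinset, Finset.mem_range] at hβ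
    obtain ⟨⟨h1, h2⟩, h3⟩ := hβ
    push Not at h3
    funext i
    simp only [ext0, Fin.is_lt, dif_pos, Fin.eta]
    by_cases c : (i : ℕ) + 1 < l
    · have := h3 i c
      have := hα1 i c
      simp only [Fin.eta] at *
      omega
    · omega
  · intro D hD
    rfl

/-- Iterated Pieri rule. -/
lemma pieri_iter {l : ℕ} (n : ℕ → ℤ) {P : MvPolynomial (Fin l) ℤ} (hP : Alt P) (m : ℕ)
    {A : ℕ → ℕ} (hA : IsPart l A) :
    cf l A ((∏ i ∈ Finset.range m, hp l (n i)) * P) =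
    ∑ T ∈ (chains l m A).filter (fun T => ∀ i < m, cont l T i = n i), cf l (T 0) P := by
  classical
  induction m generalizing A with
  | zero => simp [chains]
  | succ m ih =>
    rw [Finset.prod_range_succ, mul_comm (∏ i ∈ _, _), mul_assoc,
      pieri hA _ (alt_prod_mul hP n m)]
    rw [Finset.sum_congr rfl (fun D hD => ih (isPart_HS hA (Finset.mem_filter.1 hD).1)),
      Finset.sum_sigma']
    refine Finset.sum_bij' (fun x _ => fun k => if k ≤ m then x.2 k else A)
      (fun T _ => ⟨T m, fun k => T (min k m)⟩) ?_ ?_ ?_ ?_ ?_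
    · rintro ⟨D, T⟩ h
      simp only [Finset.mem_sigma, Finset.mem_filter] at h
      obtain ⟨⟨h1, h2⟩, h3, h4⟩ := h
      have h5 := (mem_chains (isPart_HS hA h1) T).1 h3
      rw [Finset.mem_filter]
      constructor
      · simp only [chains, Finset.mem_biUnion, Finset.mem_image]
        exact ⟨D, h1, T, h3, rfl⟩
      · intro i hi
        unfold cont
        dsimp only
        by_cases c : i < m
        · rw [if_pos (by omega), if_pos (by omega)]; exact h4 i c
        · obtain rfl : i = m := by omega
          rw [if_neg (by omega), if_pos le_rfl, h5.2 i le_rfl]; exact h2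
    · intro T h
      simp only [Finset.mem_filter, mem_chains hA] at h
      obtain ⟨⟨⟨h1, h2⟩, h3⟩, h4⟩ := h
      have e := h3 (m+1) le_rfl
      have hD : T m ∈ HS l A := by
        rw [mem_HS hA]
        intro r
        rw [← e]
        exact ⟨h2 m r, h1 m r⟩
      simp only [Finset.mem_sigma, Finset.mem_filter, mem_chains (isPart_HS hA hD)]
      refine ⟨⟨hD, ?_⟩, ⟨⟨fun k r => ?_, fun k r => ?_⟩, fun k hk => by rw [min_eq_right hk]⟩,
        fun i hi => ?_⟩
      · rw [← h4 m (by omega), ← e]; rfl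
      · dsimp only
        rcases lt_or_ge k m with c | c
        · rw [min_eq_left c.le, min_eq_left (by omega : k + 1 ≤ m)]; exact h1 k r
        · rw [min_eq_right c, min_eq_right (by omega : m ≤ k + 1)]
      · dsimp only
        rcases lt_or_ge k m with c | c
        · rw [min_eq_left c.le, min_eq_left (by omega : k + 1 ≤ m)]; exact h2 k r
        · rw [min_eq_right c, min_eq_right (by omega : m ≤ k + 1)]
          exact (isPart_HS hA hD).1 (by omega)
      · rw [← h4 i (by omega)]
        unfold cont
        dsimp only
        rw [min_eq_left (by omega : i ≤ m), min_eq_left (by omega : i + 1 ≤ m)]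
    · rintro ⟨D, T⟩ h
      simp only [Finset.mem_sigma, Finset.mem_filter] at h
      have h5 := (mem_chains (isPart_HS hA h.1.1) T).1 h.2.1
      have a1 : T m = D := h5.2 m le_rfl
      have a2 : (fun k => T (min k m)) = T := by
        funext k
        rcases lt_or_ge k m with c | c
        · rw [min_eq_left c.le]
        · rw [min_eq_right c, a1, h5.2 k c]
      simp [a1, a2]
    · intro T h
      simp only [Finset.mem_filter, mem_chains hA] at h
      funext k
      dsimp only
      split_ifs with c
      · rw [min_eq_left c]
      · exact (h.1.2 k (by omega)).symm
    · rintro ⟨D, T⟩ h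
      simp

/-- The coefficient of an alternating polynomial times a Schur polynomial. -/
lemma cf_schur_mul {l : ℕ} {B : Fin l → ℕ} (hB : Antitone B) {P : MvPolynomial (Fin l) ℤ}
    (hP : Alt P) {A : ℕ → ℕ} (hA : IsPart l A) [DecidablePred IsLR] :
    cf l A (schur l B * P) =
    ∑ T ∈ (chains l l A).filter (fun T => IsLR T ∧ ∀ i : Fin l, cont l T i = B i),
      cf l (T 0) P := by
  rw [← cancel hA hB (fun D => cf l D P)]
  unfold schur
  rw [Matrix.det_apply, Finset.sum_mul]
  conv_lhs => unfold cf
  rw [coeff_sum]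
  apply Finset.sum_congr rfl
  intro σ _
  rw [smul_mul_assoc]
  have : (∏ i, (Matrix.of fun i j : Fin l => hp l ((B i : ℤ) + (j : ℕ) - (i : ℕ))) (σ i) i) =
      ∏ i ∈ Finset.range l, hp l ((fun i => if h : i < l then
        (B (σ ⟨i, h⟩) : ℤ) - (σ ⟨i, h⟩ : ℕ) + i else 0) i) := by
    rw [Finset.prod_range]
    apply Finset.prod_congr rfl
    intro i _
    simp only [Matrix.of_apply, Fin.is_lt, dif_pos, Fin.eta]
    congr 1
    ring
  rw [this, Units.smul_def, zsmul_eq_mul, ← eq_intCast (C : ℤ →+* MvPolynomial (Fin l) ℤ),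
    coeff_C_mul]
  congr 1
  have h1 := pieri_iter (fun i => if h : i < l then
        (B (σ ⟨i, h⟩) : ℤ) - (σ ⟨i, h⟩ : ℕ) + i else 0) hP l hA
  refine (Eq.trans (by rfl) h1).trans ?_
  refine Finset.sum_congr (Finset.filter_congr fun T _ => ?_) fun _ _ => rfl
  constructor
  · intro h i
    rw [h i i.2, dif_pos i.2]
  · intro h i hi
    rw [h ⟨i, hi⟩, dif_pos hi]

/-- The coefficient of the Vandermonde alternant. -/
lemma cf_vdm {l : ℕ} {F : ℕ → ℕ} (hF : IsPart l F) [Decidable (F = 0)] :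
    cf l F (vdm l) = if F = 0 then 1 else 0 := by
  classical
  unfold cf vdm
  rw [Matrix.det_apply, coeff_sum]
  have h1 : ∀ σ : Equiv.Perm (Fin l),
      (∏ i, (Matrix.of fun i j : Fin l => (X i : MvPolynomial (Fin l) ℤ) ^ (l - 1 - (j : ℕ))) (σ i) i) =
      monomial (vv fun i => l - 1 - ((σ⁻¹ i : Fin l) : ℕ)) 1 := by
    intro σ
    rw [monomial_eq, Finsupp.prod_fintype _ _ (by simp)]
    rw [← Equiv.prod_comp σ (fun i => X i ^ (vv fun i => l - 1 - ((σ⁻¹ i : Fin l) : ℕ)) i)]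
    simp
  have h2 : ∀ σ : Equiv.Perm (Fin l), coeff (vv fun i : Fin l => F i + (l - 1 - (i : ℕ)))
      (Equiv.Perm.sign σ • ∏ i, (Matrix.of fun i j : Fin l =>
        (X i : MvPolynomial (Fin l) ℤ) ^ (l - 1 - (j : ℕ))) (σ i) i) =
      if σ = 1 ∧ F = 0 then 1 else 0 := by
    intro σ
    rw [h1, Units.smul_def, zsmul_eq_mul, ← eq_intCast (C : ℤ →+* MvPolynomial (Fin l) ℤ),
      coeff_C_mul, coeff_monomial]
    split_ifs with h3 h4 h4
    · rw [h4.1]; simp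
    · exfalso
      apply h4
      have h5 : ∀ i : Fin l, l - 1 - ((σ⁻¹ i : Fin l) : ℕ) = F i + (l - 1 - (i : ℕ)) := fun i =>
        DFunLike.congr_fun h3 i
      have h6 : σ⁻¹ = 1 := by
        apply perm_eq_one_of_strictMono
        intro i j hij
        have a1 := h5 i
        have a2 := h5 j
        have a3 : (i : ℕ) < j := hij
        have a4 := hF.1 a3.le
        have a5 := (σ⁻¹ i).2
        have a6 := (σ⁻¹ j).2
        have a7 := j.2
        rw [Fin.lt_def]
        omega
      refine ⟨inv_eq_one.1 h6, ?_⟩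
      funext r
      by_cases c : r < l
      · have := h5 ⟨r, c⟩
        rw [h6] at this
        simp at this
        simpa using this
      · exact hF.2 r (by omega)
    · exfalso
      apply h3
      obtain ⟨rfl, rfl⟩ := h4
      simp
    · simp
  rw [Finset.sum_congr rfl fun σ _ => h2 σ]
  by_cases hF0 : F = 0
  · simp [hF0]
  · simp [hF0]

/-- Existence of the pair of Littlewood-Richardson chains. -/
def Good (l : ℕ) (A : ℕ → ℕ) (B C : Fin l → ℕ) : Prop :=
  ∃ T S : ℕ → ℕ → ℕ, (IsChain T ∧ IsLR T ∧ (∀ k, l ≤ k → T k = A) ∧ ∀ i : Fin l, cont l T i = B i) ∧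
    (IsChain S ∧ IsLR S ∧ (∀ k, l ≤ k → S k = T 0) ∧ ∀ i : Fin l, cont l S i = C i) ∧ S 0 = 0

lemma chain_isPart {l : ℕ} {A : ℕ → ℕ} {T : ℕ → ℕ → ℕ} (hA : IsPart l A) (hT : IsChain T)
    (hl : ∀ k, l ≤ k → T k = A) (k : ℕ) : IsPart l (T k) := by
  refine ⟨antitone_nat_of_succ_le fun r => (hT.1 k (r+1)).trans (hT.2 k r),
    fun r hr => chain_zero hT hl hA.2 k r hr⟩

lemma isPart_ext0 {l : ℕ} {A : Fin l → ℕ} (hA : Antitone A) : IsPart l (ext0 l A) := by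
  constructor
  · intro r s hrs
    unfold ext0
    split_ifs with h1 h2
    · exact hA hrs
    · omega
    · omega
    · omega
  · intro r hr
    simp [ext0, show ¬ r < l by omega]

lemma lrCoeff_pos_iff {l : ℕ} {A B C : Fin l → ℕ} (hA : Antitone A) (hB : Antitone B)
    (hC : Antitone C) : 0 < lrCoeff l B C A ↔ Good l (ext0 l A) B C := by
  classical
  have hA' := isPart_ext0 hA
  have h0 : lrCoeff l B C A = cf l (ext0 l A) (schur l B * (schur l C * vdm l)) := by
    unfold lrCoeff schurMult cf
    rw [mul_assoc]
    congr 1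
    ext i
    simp [ext0]
  have hS : ∀ D : ℕ → ℕ, IsPart l D → cf l D (schur l C * vdm l) =
      ∑ S ∈ (chains l l D).filter (fun T => IsLR T ∧ ∀ i : Fin l, cont l T i = C i),
        if S 0 = 0 then 1 else 0 := by
    intro D hD
    rw [cf_schur_mul hC (alt_vdm l) hD]
    apply Finset.sum_congr rfl
    intro S hS
    simp only [Finset.mem_filter, mem_chains hD] at hS
    rw [cf_vdm (chain_isPart hD hS.1.1 hS.1.2 0)]
  have hnn : ∀ D : ℕ → ℕ, IsPart l D → 0 ≤ cf l D (schur l C * vdm l) := by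
    intro D hD
    rw [hS D hD]
    exact Finset.sum_nonneg fun S _ => by split_ifs <;> simp
  rw [h0, cf_schur_mul hB (alt_schur_mul (alt_vdm l) C) hA', Finset.sum_pos_iff_of_nonneg]
  · constructor
    · rintro ⟨T, hT, hpos⟩
      simp only [Finset.mem_filter, mem_chains hA'] at hT
      have hD := chain_isPart hA' hT.1.1 hT.1.2 0
      rw [hS _ hD, Finset.sum_pos_iff_of_nonneg (fun S _ => by split_ifs <;> simp)] at hpos
      obtain ⟨S, hS', hpos⟩ := hpos
      simp only [Finset.mem_filter, mem_chains hD] at hS'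
      refine ⟨T, S, ⟨hT.1.1, hT.2.1, hT.1.2, hT.2.2⟩, ⟨hS'.1.1, hS'.2.1, hS'.1.2, hS'.2.2⟩, ?_⟩
      by_contra hc
      simp [hc] at hpos
    · rintro ⟨T, S, ⟨t1, t2, t3, t4⟩, ⟨s1, s2, s3, s4⟩, h⟩
      have hD := chain_isPart hA' t1 t3 0
      refine ⟨T, ?_, ?_⟩
      · simp only [Finset.mem_filter, mem_chains hA']
        exact ⟨⟨t1, t3⟩, t2, t4⟩
      · rw [hS _ hD, Finset.sum_pos_iff_of_nonneg (fun S _ => by split_ifs <;> simp)]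
        refine ⟨S, ?_, by simp [h]⟩
        simp only [Finset.mem_filter, mem_chains hD]
        exact ⟨⟨s1, s3⟩, s2, s4⟩
  · intro T hT
    simp only [Finset.mem_filter, mem_chains hA'] at hT
    exact hnn _ (chain_isPart hA' hT.1.1 hT.1.2 0)

lemma isChain_add {T S : ℕ → ℕ → ℕ} (hT : IsChain T) (hS : IsChain S) : IsChain (T + S) :=
  ⟨fun k r => add_le_add (hT.1 k r) (hS.1 k r), fun k r => add_le_add (hT.2 k r) (hS.2 k r)⟩

lemma isLR_add {T S : ℕ → ℕ → ℕ} (hT : IsLR T) (hS : IsLR S) : IsLR (T + S) := by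
  intro i r
  have h1 := hT i r
  have h2 := hS i r
  have h3 : ex (T + S) i r = ex T i r + ex S i r := by
    unfold ex
    rw [← Finset.sum_add_distrib]
    apply Finset.sum_congr rfl
    intro s _
    simp only [Pi.add_apply]; push_cast; ring
  unfold EE at *
  rw [h3]
  simp only [Pi.add_apply]; push_cast; linarith

lemma cont_add (l : ℕ) (T S : ℕ → ℕ → ℕ) (i : ℕ) :
    cont l (T + S) i = cont l T i + cont l S i := by
  unfold cont
  rw [← Finset.sum_add_distrib]
  apply Finset.sum_congr rfl
  intro s _
  simp only [Pi.add_apply]; push_cast; ring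

lemma good_add {l : ℕ} {A A' : ℕ → ℕ} {B B' C C' : Fin l → ℕ} (h : Good l A B C)
    (h' : Good l A' B' C') : Good l (A + A') (fun i => B i + B' i) (fun i => C i + C' i) := by
  obtain ⟨T, S, ⟨t1, t2, t3, t4⟩, ⟨s1, s2, s3, s4⟩, h⟩ := h
  obtain ⟨T', S', ⟨t1', t2', t3', t4'⟩, ⟨s1', s2', s3', s4'⟩, h'⟩ := h'
  refine ⟨T + T', S + S', ⟨isChain_add t1 t1', isLR_add t2 t2', fun k hk => ?_, fun i => ?_⟩,
    ⟨isChain_add s1 s1', isLR_add s2 s2', fun k hk => ?_, fun i => ?_⟩, ?_⟩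
  · rw [Pi.add_apply, t3 k hk, t3' k hk]
  · rw [cont_add, t4, t4']; push_cast; rfl
  · rw [Pi.add_apply, Pi.add_apply, s3 k hk, s3' k hk]
  · rw [cont_add, s4, s4']; push_cast; rfl
  · rw [Pi.add_apply, h, h', add_zero]

end LRProof

/-- If the Littlewood–Richardson coefficients `c^{A₁}_{B₁,C₁}` and
`c^{A₂}_{B₂,C₂}` are positive, then so is `c^{A₁+A₂}_{B₁+B₂,C₁+C₂}` (partitions are
represented as weakly decreasing `l`-tuples for an arbitrary common length `l`). -/
theorem lrCoeff_pos_add (l : ℕ) (A₁ A₂ B₁ B₂ C₁ C₂ : Fin l → ℕ)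
    (hA₁ : Antitone A₁) (hA₂ : Antitone A₂) (hB₁ : Antitone B₁) (hB₂ : Antitone B₂)
    (hC₁ : Antitone C₁) (hC₂ : Antitone C₂)
    (h₁ : 0 < lrCoeff l B₁ C₁ A₁) (h₂ : 0 < lrCoeff l B₂ C₂ A₂) :
    0 < lrCoeff l (fun i => B₁ i + B₂ i) (fun i => C₁ i + C₂ i) (fun i => A₁ i + A₂ i) := by
  rw [LRProof.lrCoeff_pos_iff hA₁ hB₁ hC₁] at h₁
  rw [LRProof.lrCoeff_pos_iff hA₂ hB₂ hC₂] at h₂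
  rw [LRProof.lrCoeff_pos_iff (fun i j h => add_le_add (hA₁ h) (hA₂ h))
    (fun i j h => add_le_add (hB₁ h) (hB₂ h)) (fun i j h => add_le_add (hC₁ h) (hC₂ h))]
  have h := LRProof.good_add h₁ h₂
  have e : LRProof.ext0 l A₁ + LRProof.ext0 l A₂ = LRProof.ext0 l (fun i => A₁ i + A₂ i) := by
    funext r
    simp only [LRProof.ext0, Pi.add_apply]
    split_ifs <;> rfl
  rwa [e] at h
end

section
/- For all partitions A and C, the Littlewood–Richardson coefficient c^{A+C}_{A,C} is positive, and every partition P with c^{P}_{A,C} > 0 satisfies P ⪯ A+C in the dominance order; in particular every such P different from A+C satisfies P ≺ A+C. -/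
open Finset MvPolynomial

namespace LRAux

/-- generating series of a single variable -/
noncomputable def geo (l : ℕ) (k : Fin l) : PowerSeries (MvPolynomial (Fin l) ℤ) :=
  PowerSeries.mk fun n => (X k : MvPolynomial (Fin l) ℤ) ^ n

lemma geo_mul (l : ℕ) (k : Fin l) :
    geo l k * (1 - PowerSeries.C (X k : MvPolynomial (Fin l) ℤ) * PowerSeries.X) = 1 := by
  ext1 n
  rw [mul_sub, mul_one, ← mul_assoc, mul_comm (geo l k), mul_assoc, map_sub,
    PowerSeries.coeff_C_mul]
  cases n with
  | zero => simp [geo]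
  | succ n =>
    rw [PowerSeries.coeff_succ_mul_X]
    simp [geo, PowerSeries.coeff_one, pow_succ']

lemma hsymm_gen (l : ℕ) :
    PowerSeries.mk (fun n => hsymm (Fin l) ℤ n) = ∏ k : Fin l, geo l k := by
  ext1 n
  rw [PowerSeries.coeff_prod, PowerSeries.coeff_mk, hsymm]
  refine Finset.sum_bij (fun s _ => Multiset.toFinsupp (s : Multiset (Fin l))) ?_ ?_ ?_ ?_
  · intro s _
    rw [mem_finsuppAntidiag]
    refine ⟨?_, subset_univ _⟩
    exact (Multiset.sum_count_eq_card (s := univ) (fun a _ => mem_univ a)).trans s.2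
  · intro a _ b _ h
    exact Sym.coe_injective (Multiset.toFinsupp.injective h)
  · intro f hf
    simp only [mem_finsuppAntidiag, subset_univ, and_true] at hf
    have hc : (Finsupp.toMultiset f).card = n := by
      rw [Finsupp.card_toMultiset, Finsupp.sum_fintype _ _ (by simp)]
      exact hf
    exact ⟨Sym.mk (Finsupp.toMultiset f) hc, mem_univ _, Finsupp.toMultiset_toFinsupp f⟩
  · intro s _
    simp only [geo, PowerSeries.coeff_mk, Multiset.toFinsupp_apply]
    rw [Finset.prod_multiset_map_count]
    refine Finset.prod_subset (subset_univ _) ?_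
    intro x _ hx
    rw [Multiset.mem_toFinset] at hx
    have : Multiset.count x (s : Multiset (Fin l)) = 0 := Multiset.count_eq_zero.2 hx
    exact (congrArg (fun t => (X x : MvPolynomial (Fin l) ℤ) ^ t) this).trans (pow_zero _)

/-- the product of `1 - x_m t` over `m ≠ k` -/
noncomputable def epol (l : ℕ) (k : Fin l) : Polynomial (MvPolynomial (Fin l) ℤ) :=
  ∏ m ∈ univ.erase k, (1 - Polynomial.C (X m : MvPolynomial (Fin l) ℤ) * Polynomial.X)

lemma epol_deg (l : ℕ) (k : Fin l) : (epol l k).natDegree ≤ l - 1 := by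
  refine (Polynomial.natDegree_prod_le _ _).trans ?_
  refine (Finset.sum_le_card_nsmul _ _ 1 ?_).trans ?_
  · intro m _
    refine (Polynomial.natDegree_sub_le _ _).trans ?_
    simp only [Polynomial.natDegree_one, zero_le, sup_of_le_right]
    exact (Polynomial.natDegree_C_mul_le _ _).trans Polynomial.natDegree_X_le
  · simp [Finset.card_erase_of_mem]

lemma gen_mul_epol (l : ℕ) (k : Fin l) :
    PowerSeries.mk (fun n => hsymm (Fin l) ℤ n) *
      (epol l k : PowerSeries (MvPolynomial (Fin l) ℤ)) = geo l k := by
  rw [hsymm_gen, ← Finset.mul_prod_erase univ _ (mem_univ k), mul_assoc, epol]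
  have : ((∏ m ∈ univ.erase k,
      (1 - Polynomial.C (X m : MvPolynomial (Fin l) ℤ) * Polynomial.X) :
        Polynomial (MvPolynomial (Fin l) ℤ)) : PowerSeries (MvPolynomial (Fin l) ℤ)) =
      ∏ m ∈ univ.erase k,
        (1 - PowerSeries.C (X m : MvPolynomial (Fin l) ℤ) * PowerSeries.X) := by
    rw [← Polynomial.coeToPowerSeries.ringHom_apply, map_prod]
    simp
  rw [this, ← Finset.prod_mul_distrib, Finset.prod_congr rfl (fun m _ => geo_mul l m)]
  simp

lemma hp_sum (l : ℕ) (k : Fin l) (N : ℕ) :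
    ∑ q ∈ range l, hp l ((N : ℤ) - q) * (epol l k).coeff q = X k ^ N := by
  have h := congrArg (PowerSeries.coeff N) (gen_mul_epol l k)
  rw [mul_comm, PowerSeries.coeff_mul, Nat.sum_antidiagonal_eq_sum_range_succ_mk] at h
  simp only [geo, PowerSeries.coeff_mk, Polynomial.coeff_coe] at h
  rw [← h]
  have h1 : ∑ q ∈ range l, hp l ((N : ℤ) - q) * (epol l k).coeff q =
      ∑ q ∈ range (l + (N + 1)), hp l ((N : ℤ) - q) * (epol l k).coeff q := by
    refine Finset.sum_subset (by simp) ?_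
    intro q _ hq
    rw [Polynomial.coeff_eq_zero_of_natDegree_lt, mul_zero]
    have := epol_deg l k
    have := k.2
    simp at hq
    omega
  rw [h1]
  symm
  have h2 : ∀ q ∈ range (N + 1), (epol l k).coeff q * hsymm (Fin l) ℤ (N - q) =
      hp l ((N : ℤ) - q) * (epol l k).coeff q := by
    intro q hq
    simp at hq
    rw [mul_comm, hp, if_pos (by omega)]
    congr 2
    omega
  rw [Finset.sum_congr rfl h2]
  refine Finset.sum_subset (by simp) ?_
  intro q _ hq
  simp at hq
  rw [hp, if_neg (by omega), zero_mul]

/-- alternants -/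
noncomputable def alt (l : ℕ) (a : Fin l → ℕ) : MvPolynomial (Fin l) ℤ :=
  Matrix.det (Matrix.of fun i j : Fin l => (X i : MvPolynomial (Fin l) ℤ) ^ a j)

/-- the shifted exponent -/
def sh (l : ℕ) (A : Fin l → ℕ) : Fin l → ℕ := fun i => A i + (l - 1 - (i : ℕ))

lemma schur_mul_e (l : ℕ) (A : Fin l → ℕ) :
    schur l A * Matrix.det (Matrix.of fun j k : Fin l => (epol l k).coeff (l - 1 - (j : ℕ))) =
      alt l (sh l A) := by
  rw [schur, ← Matrix.det_mul, alt, ← Matrix.det_transpose]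
  congr 1
  ext1 k i
  rw [Matrix.transpose_apply, Matrix.mul_apply]
  simp only [Matrix.of_apply]
  rw [← hp_sum l k (sh l A i), ← Finset.sum_range_reflect, Finset.sum_range]
  refine Finset.sum_congr rfl fun j _ => ?_
  congr 2
  have := i.2
  have := j.2
  simp only [sh]
  omega

lemma schur_zero (l : ℕ) : schur l (fun _ => 0) = 1 := by
  rw [schur, Matrix.det_of_isUpperTriangular]
  · simp [hp]
  · intro i j hij
    simp only [id] at hij
    simp only [Matrix.of_apply]
    rw [hp, if_neg]
    have : (j : ℕ) < i := hij
    push_cast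
    omega

lemma schur_mul_vdm (l : ℕ) (A : Fin l → ℕ) : schur l A * vdm l = alt l (sh l A) := by
  have h0 := schur_mul_e l (fun _ => 0)
  rw [schur_zero, one_mul] at h0
  have hv : vdm l = alt l (sh l fun _ => 0) := by simp [vdm, alt, sh]
  rw [hv, ← h0, schur_mul_e]

lemma alt_coeff (l : ℕ) (a : Fin l → ℕ) (m : Fin l →₀ ℕ) :
    coeff m (alt l a) = ∑ σ : Equiv.Perm (Fin l),
      if (fun i => a (σ i)) = m then ((Equiv.Perm.sign σ : ℤˣ) : ℤ) else 0 := by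
  rw [alt, ← Matrix.det_transpose, Matrix.det_apply, coeff_sum]
  refine Finset.sum_congr rfl fun σ _ => ?_
  have : ∏ i, (Matrix.of fun i j : Fin l => (X i : MvPolynomial (Fin l) ℤ) ^ a j).transpose
      (σ i) i = monomial (Finsupp.equivFunOnFinite.symm fun i => a (σ i)) 1 := by
    rw [monomial_eq, Finsupp.prod_fintype _ _ (by simp)]
    simp
  rw [this, Units.smul_def, coeff_smul, coeff_monomial, smul_eq_mul]
  by_cases h : (fun i => a (σ i)) = m
  · rw [if_pos h, if_pos, mul_one]
    ext i
    simpa using congrFun h i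
  · rw [if_neg h, if_neg, mul_zero]
    rintro rfl
    exact h (by ext i; simp)

lemma alt_coeff_self (l : ℕ) (a : Fin l → ℕ) (ha : Function.Injective a) :
    coeff (Finsupp.equivFunOnFinite.symm a) (alt l a) = 1 := by
  rw [alt_coeff, Finset.sum_eq_single 1]
  · simp
  · intro σ _ hσ
    rw [if_neg]
    intro h
    apply hσ
    ext i
    have := congrFun h i
    simp at this
    simp [ha this]
  · simp

lemma alt_supp (l : ℕ) (a : Fin l → ℕ) (m : Fin l →₀ ℕ) (h : coeff m (alt l a) ≠ 0) :
    ∃ σ : Equiv.Perm (Fin l), (fun i => a (σ i)) = m := by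
  by_contra! hc
  apply h
  rw [alt_coeff]
  exact Finset.sum_eq_zero fun σ _ => if_neg (hc σ)

/-- weight of an exponent -/
def wt (l : ℕ) (w : Fin l → ℕ) (m : Fin l → ℕ) : ℕ := ∑ i, w i * m i

/-- grading homomorphism -/
noncomputable def phi (l : ℕ) (w : Fin l → ℕ) :
    MvPolynomial (Fin l) ℤ →ₐ[ℤ] Polynomial (MvPolynomial (Fin l) ℤ) :=
  aeval fun i => Polynomial.C (X i) * Polynomial.X ^ w i

lemma phi_coeff (l : ℕ) (w : Fin l → ℕ) (p : MvPolynomial (Fin l) ℤ) (m : Fin l →₀ ℕ) (n : ℕ) :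
    coeff m ((phi l w p).coeff n) = if wt l w m = n then coeff m p else 0 := by
  induction p using MvPolynomial.induction_on' with
  | monomial u a =>
    have : phi l w (monomial u a) = Polynomial.C (monomial u a) * Polynomial.X ^ wt l w u := by
      rw [phi, aeval_monomial, monomial_eq, Finsupp.prod_fintype _ _ (by simp),
        Finsupp.prod_fintype _ _ (by simp)]
      simp only [mul_pow, Finset.prod_mul_distrib, ← pow_mul, Finset.prod_pow_eq_pow_sum, wt]
      simp [mul_assoc]
    rw [this, Polynomial.coeff_C_mul_X_pow]
    by_cases h : u = m
    · subst h
      simp only [eq_comm (a := n)]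
      split_ifs <;> simp
    · simp only [coeff_monomial, if_neg h, ite_self]
      split_ifs <;> simp [coeff_monomial, h]
  | add p q hp hq =>
    simp only [map_add, Polynomial.coeff_add, coeff_add, hp, hq]
    split_ifs <;> simp

lemma phi_ne (l : ℕ) (w : Fin l → ℕ) (p : MvPolynomial (Fin l) ℤ) (m : Fin l →₀ ℕ)
    (h : coeff m p ≠ 0) : (phi l w p).coeff (wt l w m) ≠ 0 := by
  intro hc
  apply h
  have := phi_coeff l w p m (wt l w m)
  rw [hc, if_pos rfl] at this
  simpa using this.symm

lemma phi_supp (l : ℕ) (w : Fin l → ℕ) (p : MvPolynomial (Fin l) ℤ) (n : ℕ)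
    (h : (phi l w p).coeff n ≠ 0) : ∃ m, coeff m p ≠ 0 ∧ wt l w m = n := by
  obtain ⟨m, hm⟩ := MvPolynomial.ne_zero_iff.1 h
  rw [phi_coeff] at hm
  by_cases hw : wt l w m = n
  · rw [if_pos hw] at hm
    exact ⟨m, hm, hw⟩
  · rw [if_neg hw] at hm
    exact absurd rfl hm

lemma top_mul (l : ℕ) (w : Fin l → ℕ) (F G H : MvPolynomial (Fin l) ℤ) (hFG : F * G = H)
    (m m0 : Fin l →₀ ℕ) (d' : ℕ) (hm : coeff m F ≠ 0) (hm0 : coeff m0 G ≠ 0)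
    (hH : ∀ n, coeff n H ≠ 0 → wt l w n ≤ d') : wt l w m + wt l w m0 ≤ d' := by
  have h1 := phi_ne l w F m hm
  have h2 := phi_ne l w G m0 hm0
  have hF : phi l w F ≠ 0 := fun h => h1 (by simp [h])
  have hG : phi l w G ≠ 0 := fun h => h2 (by simp [h])
  have h3 := Polynomial.natDegree_mul hF hG
  rw [← map_mul, hFG] at h3
  have hH0 : phi l w H ≠ 0 := by rw [← hFG, map_mul]; exact mul_ne_zero hF hG
  obtain ⟨n, hn, hn'⟩ := phi_supp l w H (phi l w H).natDegree
    (by simpa using hH0)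
  have := hH n hn
  have := Polynomial.le_natDegree_of_ne_zero h1
  have := Polynomial.le_natDegree_of_ne_zero h2
  omega

lemma bot_mul (l : ℕ) (w : Fin l → ℕ) (F G H : MvPolynomial (Fin l) ℤ) (hFG : F * G = H)
    (m m0 : Fin l →₀ ℕ) (d' : ℕ) (hm : coeff m F ≠ 0) (hm0 : coeff m0 G ≠ 0)
    (hH : ∀ n, coeff n H ≠ 0 → d' ≤ wt l w n) : d' ≤ wt l w m + wt l w m0 := by
  have h1 := phi_ne l w F m hm
  have h2 := phi_ne l w G m0 hm0
  have hF : phi l w F ≠ 0 := fun h => h1 (by simp [h])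
  have hG : phi l w G ≠ 0 := fun h => h2 (by simp [h])
  have h3 := Polynomial.natTrailingDegree_mul hF hG
  rw [← map_mul, hFG] at h3
  have hH0 : phi l w H ≠ 0 := by rw [← hFG, map_mul]; exact mul_ne_zero hF hG
  obtain ⟨n, hn, hn'⟩ := phi_supp l w H (phi l w H).natTrailingDegree
    (by simpa using hH0)
  have := hH n hn
  have := Polynomial.natTrailingDegree_le_of_ne_zero h1
  have := Polynomial.natTrailingDegree_le_of_ne_zero h2
  omega

lemma coeff_mul_ne (l : ℕ) (F G : MvPolynomial (Fin l) ℤ) (n : Fin l →₀ ℕ)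
    (h : coeff n (F * G) ≠ 0) :
    ∃ p q, p + q = n ∧ coeff p F ≠ 0 ∧ coeff q G ≠ 0 := by
  rw [coeff_mul] at h
  obtain ⟨x, hx, hx'⟩ := Finset.exists_ne_zero_of_sum_ne_zero h
  exact ⟨x.1, x.2, by simpa using hx, left_ne_zero_of_mul hx', right_ne_zero_of_mul hx'⟩

/-- partial-sum weights -/
def pw (l r : ℕ) : Fin l → ℕ := fun i => if (i : ℕ) < r then 1 else 0

lemma wt_pw (l r : ℕ) (m : Fin l → ℕ) :
    wt l (pw l r) m = ∑ i ∈ univ.filter (fun i : Fin l => (i : ℕ) < r), m i := by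
  simp [wt, pw, Finset.sum_filter]

lemma wt_add (l : ℕ) (w m n : Fin l → ℕ) :
    wt l w (fun i => m i + n i) = wt l w m + wt l w n := by
  simp [wt, mul_add, Finset.sum_add_distrib]

lemma wt_perm (l r : ℕ) (a : Fin l → ℕ) (ha : Antitone a) (σ : Equiv.Perm (Fin l)) :
    wt l (pw l r) (fun i => a (σ i)) ≤ wt l (pw l r) a := by
  have hp : Antitone (pw l r) := by
    intro i j hij
    have : (i : ℕ) ≤ j := hij
    simp only [pw]
    split_ifs <;> omega
  exact (hp.monovary ha).sum_mul_comp_perm_le_sum_mul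

lemma wt_one_perm (l : ℕ) (a : Fin l → ℕ) (σ : Equiv.Perm (Fin l)) :
    wt l (fun _ => 1) (fun i => a (σ i)) = wt l (fun _ => 1) a := by
  simp only [wt, one_mul]
  exact Equiv.sum_comp σ a

lemma eq_of_wt (l : ℕ) (m n : Fin l → ℕ) (h : ∀ r, wt l (pw l r) m = wt l (pw l r) n) :
    m = n := by
  have key : ∀ (m : Fin l → ℕ) (i : Fin l),
      wt l (pw l (i + 1)) m = wt l (pw l i) m + m i := by
    intro m i
    have : m i = ∑ j, if j = i then m j else 0 := by simp
    rw [this, wt, wt, ← Finset.sum_add_distrib]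
    refine Finset.sum_congr rfl fun j _ => ?_
    simp only [pw, Fin.ext_iff]
    split_ifs <;> omega
  ext i
  have h1 := h (i + 1)
  rw [key, key, h i] at h1
  omega

lemma sh_strict (l : ℕ) (A : Fin l → ℕ) (hA : Antitone A) : StrictAnti (sh l A) := by
  intro i j hij
  have := hA hij.le
  have : (i : ℕ) < j := hij
  have := j.2
  simp only [sh]
  omega

/-- dominated coefficients multiply at the top -/
lemma coeff_top (l : ℕ) (F G : MvPolynomial (Fin l) ℤ) (a b : Fin l → ℕ)
    (hF : ∀ m, coeff m F ≠ 0 → ∀ r, wt l (pw l r) m ≤ wt l (pw l r) a)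
    (hG : ∀ m, coeff m G ≠ 0 → ∀ r, wt l (pw l r) m ≤ wt l (pw l r) b) :
    coeff (Finsupp.equivFunOnFinite.symm fun i => a i + b i) (F * G) =
      coeff (Finsupp.equivFunOnFinite.symm a) F * coeff (Finsupp.equivFunOnFinite.symm b) G := by
  rw [coeff_mul, Finset.sum_eq_single
    (Finsupp.equivFunOnFinite.symm a, Finsupp.equivFunOnFinite.symm b)]
  · rintro ⟨p, q⟩ hpq hne
    rw [HasAntidiagonal.mem_antidiagonal] at hpq
    by_contra hc
    have h1 := hF p (left_ne_zero_of_mul hc)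
    have h2 := hG q (right_ne_zero_of_mul hc)
    have h3 : (fun i => p i + q i) = fun i => a i + b i := by
      ext i
      simpa using DFunLike.congr_fun hpq i
    have h4 : ∀ r, wt l (pw l r) p + wt l (pw l r) q = wt l (pw l r) a + wt l (pw l r) b := by
      intro r
      rw [← wt_add, ← wt_add, h3]
    have hp : (p : Fin l → ℕ) = a := eq_of_wt l _ _ fun r => by
      have := h1 r; have := h2 r; have := h4 r; omega
    have hq : (q : Fin l → ℕ) = b := eq_of_wt l _ _ fun r => by
      have := h1 r; have := h2 r; have := h4 r; omega
    apply hne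
    ext i
    · simp [← hp]
    · simp [← hq]
  · intro h
    exfalso
    apply h
    rw [HasAntidiagonal.mem_antidiagonal]
    ext i
    simp

lemma alt_dom (l : ℕ) (a : Fin l → ℕ) (ha : Antitone a) (m : Fin l →₀ ℕ)
    (h : coeff m (alt l a) ≠ 0) (r : ℕ) : wt l (pw l r) m ≤ wt l (pw l r) a := by
  obtain ⟨σ, hσ⟩ := alt_supp l a m h
  rw [← hσ]
  exact wt_perm l r a ha σ

lemma alt_wt_one (l : ℕ) (a : Fin l → ℕ) (m : Fin l →₀ ℕ)
    (h : coeff m (alt l a) ≠ 0) : wt l (fun _ => 1) m = wt l (fun _ => 1) a := by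
  obtain ⟨σ, hσ⟩ := alt_supp l a m h
  rw [← hσ]
  exact wt_one_perm l a σ

end LRAux

open LRAux

/-- For all partitions `A`, `C`, the coefficient `c^{A+C}_{A,C}` is
positive, and every partition `P` with `c^{P}_{A,C} > 0` has the same weight as `A + C`
and satisfies `P ⪯ A + C`; in particular if moreover `P ≠ A + C` then `P ≺ A + C`. -/
theorem lrCoeff_sum_pos_and_dominates (l : ℕ) (A C : Fin l → ℕ)
    (hA : Antitone A) (hC : Antitone C) :
    0 < lrCoeff l A C (fun i => A i + C i) ∧
    ∀ P : Fin l → ℕ, Antitone P → 0 < lrCoeff l A C P →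
      ((∑ i, P i = ∑ i, A i + ∑ i, C i) ∧ Dom l (fun i => A i + C i) P ∧
        (P ≠ (fun i => A i + C i) →
          Dom l (fun i => A i + C i) P ∧ P ≠ fun i => A i + C i)) := by
  set F := schur l A * schur l C * vdm l with hFdef
  obtain ⟨δ, hδdef⟩ : ∃ d : Fin l → ℕ, d = sh l (fun _ => 0) := ⟨_, rfl⟩
  have hshP : ∀ (P : Fin l → ℕ) w, wt l w (sh l P) = wt l w P + wt l w δ := fun P w => by
    rw [← wt_add]
    congr 1
    ext i
    simp [sh, hδdef]
  have hv : vdm l = alt l δ := by simp [vdm, alt, sh, hδdef]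
  have hδ : StrictAnti δ := hδdef ▸ sh_strict l _ (fun _ _ _ => le_rfl)
  have hA' := sh_strict l A hA
  have hC' := sh_strict l C hC
  have hF : F * alt l δ = alt l (sh l A) * alt l (sh l C) := by
    rw [← schur_mul_vdm, ← schur_mul_vdm, ← hv, hFdef]
    ring
  have hδ1 := alt_coeff_self l δ hδ.injective
  have hshA : ∀ w, wt l w (sh l A) = wt l w A + wt l w δ := hshP A
  have hshC : ∀ w, wt l w (sh l C) = wt l w C + wt l w δ := hshP C
  have hdom : ∀ m, coeff m F ≠ 0 → ∀ r,
      wt l (pw l r) m ≤ wt l (pw l r) (sh l fun i => A i + C i) := by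
    intro m hm r
    have := top_mul l (pw l r) F _ _ hF m (Finsupp.equivFunOnFinite.symm δ)
      (wt l (pw l r) (sh l A) + wt l (pw l r) (sh l C)) hm (by rw [hδ1]; simp) (by
        intro n hn
        obtain ⟨p, q, rfl, hp, hq⟩ := coeff_mul_ne l _ _ n hn
        have h1 := alt_dom l _ hA'.antitone p hp r
        have h2 := alt_dom l _ hC'.antitone q hq r
        have h3 := wt_add l (pw l r) p q
        exact h3.trans_le (add_le_add h1 h2))
    have h4 : wt l (pw l r) (sh l fun i => A i + C i) =
        wt l (pw l r) A + wt l (pw l r) C + wt l (pw l r) δ := by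
      rw [hshP, wt_add]
    rw [hshA, hshC] at this
    simp only [Finsupp.coe_equivFunOnFinite_symm] at this
    omega
  have hsum : ∀ m, coeff m F ≠ 0 →
      wt l (fun _ => 1) A + wt l (fun _ => 1) C + wt l (fun _ => 1) δ ≤ wt l (fun _ => 1) m := by
    intro m hm
    have := bot_mul l (fun _ => 1) F _ _ hF m (Finsupp.equivFunOnFinite.symm δ)
      (wt l (fun _ => 1) (sh l A) + wt l (fun _ => 1) (sh l C)) hm (by rw [hδ1]; simp) (by
        intro n hn
        obtain ⟨p, q, rfl, hp, hq⟩ := coeff_mul_ne l _ _ n hn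
        have h1 := alt_wt_one l _ p hp
        have h2 := alt_wt_one l _ q hq
        have h3 := wt_add l (fun _ => 1) p q
        rw [← h1, ← h2]
        exact h3.ge)
    rw [hshA, hshC] at this
    simp only [Finsupp.coe_equivFunOnFinite_symm] at this
    omega
  have hlr : ∀ P, lrCoeff l A C P = coeff (Finsupp.equivFunOnFinite.symm (sh l P)) F :=
    fun P => rfl
  refine ⟨?_, ?_⟩
  · rw [hlr]
    have h1 := coeff_top l F (alt l δ) (sh l fun i => A i + C i) δ hdom
      (alt_dom l δ hδ.antitone)
    have h2 := coeff_top l (alt l (sh l A)) (alt l (sh l C)) (sh l A) (sh l C)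
      (alt_dom l _ hA'.antitone) (alt_dom l _ hC'.antitone)
    rw [alt_coeff_self l _ hA'.injective, alt_coeff_self l _ hC'.injective, ← hF] at h2
    have h3 : (fun i => sh l A i + sh l C i) = fun i => sh l (fun i => A i + C i) i + δ i := by
      ext i
      simp only [sh, hδdef]
      omega
    rw [h3, h1, hδ1] at h2
    simp only [mul_one] at h2
    rw [h2]
    exact one_pos
  · intro P _ hPpos
    rw [hlr] at hPpos
    have hD : Dom l (fun i => A i + C i) P := by
      intro r
      rw [← wt_pw, ← wt_pw]
      have := hdom _ hPpos.ne' r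
      simp only [Finsupp.coe_equivFunOnFinite_symm] at this
      rw [hshP, hshP] at this
      omega
    refine ⟨?_, hD, fun h => ⟨hD, h⟩⟩
    have h1 := hsum _ hPpos.ne'
    simp only [Finsupp.coe_equivFunOnFinite_symm] at h1
    rw [hshP] at h1
    have h2 := hD l
    simp only [Fin.is_lt, Finset.filter_true] at h2
    rw [Finset.sum_add_distrib] at h2
    simp only [wt, one_mul] at h1
    omega
end

section
/- Let A and B be partitions of length at most l such that the l-tuple A + χ(B), whose i-th entry is a_i − b_{l+1−i}, is a partition (weakly decreasing with nonnegative entries). Then the Littlewood–Richardson coefficient c^{A}_{A+χ(B), B} is positive. -/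
open Finset MvPolynomial

/-- The alternant `a_α = det (x_i ^ α_j)`. -/
noncomputable def altp (l : ℕ) (α : Fin l → ℕ) : MvPolynomial (Fin l) ℤ :=
  Matrix.det (Matrix.of fun i j : Fin l => (X i : MvPolynomial (Fin l) ℤ) ^ (α j))

lemma hgen (l : ℕ) : PowerSeries.mk (fun k => hsymm (Fin l) ℤ k) =
    ∏ i : Fin l, PowerSeries.mk (fun k => (X i : MvPolynomial (Fin l) ℤ) ^ k) := by
  ext1 k
  rw [PowerSeries.coeff_prod, PowerSeries.coeff_mk, hsymm]
  simp only [PowerSeries.coeff_mk]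
  refine Finset.sum_bij' (fun s _ => Multiset.toFinsupp s.1)
    (fun f hf => ⟨Finsupp.toMultiset f, by
      rw [mem_finsuppAntidiag] at hf
      rw [Finsupp.card_toMultiset, ← hf.1, Finsupp.sum_fintype _ _ (by simp)]
      rfl⟩) ?_ ?_ ?_ ?_ ?_
  · intro s _
    rw [mem_finsuppAntidiag]
    refine ⟨?_, by simp⟩
    change ∑ i, Multiset.count i s.1 = k
    rw [Multiset.sum_count_eq_card (by simp)]
    exact s.2
  · intros; exact Finset.mem_univ _
  · intro s _; ext; simp
  · intro s _; simp
  · intro s _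
    simp only [Multiset.toFinsupp_apply]
    rw [Finset.prod_multiset_map_count]
    refine Finset.prod_subset (by simp) ?_
    intro i _ hi
    have : Multiset.count i s.1 = 0 := by simpa using hi
    rw [this, pow_zero]

lemma geo (l : ℕ) (i : Fin l) : PowerSeries.mk (fun k => (X i : MvPolynomial (Fin l) ℤ) ^ k) *
    ((1 - Polynomial.C (X i) * Polynomial.X : Polynomial (MvPolynomial (Fin l) ℤ)) : PowerSeries (MvPolynomial (Fin l) ℤ)) = 1 := by
  ext1 k
  simp only [Polynomial.coe_sub, Polynomial.coe_one, Polynomial.coe_mul, Polynomial.coe_C,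
    Polynomial.coe_X, mul_sub, mul_one]
  rw [← mul_assoc, mul_comm _ (PowerSeries.C _), map_sub, mul_assoc, PowerSeries.coeff_C_mul]
  cases k with
  | zero => simp
  | succ k => simp [pow_succ, mul_comm, PowerSeries.coeff_one]

/-- `∏_{j ≠ i} (1 - x_j t)`. -/
noncomputable def Pm (l : ℕ) (i : Fin l) : Polynomial (MvPolynomial (Fin l) ℤ) :=
  ∏ j ∈ Finset.univ.erase i, (1 - Polynomial.C (X j) * Polynomial.X)

lemma Pm_deg (l : ℕ) (i : Fin l) : (Pm l i).natDegree ≤ l - 1 := by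
  unfold Pm
  refine (Polynomial.natDegree_prod_le _ _).trans ?_
  refine (Finset.sum_le_card_nsmul _ _ 1 ?_).trans ?_
  · intro j _
    compute_degree
  · simp

lemma hPm (l : ℕ) (i : Fin l) : PowerSeries.mk (fun k => hsymm (Fin l) ℤ k) *
    (Pm l i : PowerSeries (MvPolynomial (Fin l) ℤ)) =
    PowerSeries.mk (fun k => (X i : MvPolynomial (Fin l) ℤ) ^ k) := by
  rw [hgen, Pm, ← Finset.mul_prod_erase _ _ (Finset.mem_univ i), mul_assoc]
  rw [← Polynomial.coeToPowerSeries.ringHom_apply, map_prod, ← Finset.prod_mul_distrib]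
  rw [Finset.prod_eq_one, mul_one]
  intro j _
  exact geo l j

lemma pow_eq (l : ℕ) (i : Fin l) (k : ℕ) : (X i : MvPolynomial (Fin l) ℤ) ^ k =
    ∑ j : Fin l, hp l ((k : ℤ) - ((l - 1 - (j : ℕ) : ℕ) : ℤ)) * (Pm l i).coeff (l - 1 - j) := by
  have h := congrArg (PowerSeries.coeff k) (hPm l i)
  rw [PowerSeries.coeff_mk, PowerSeries.coeff_mul] at h
  rw [← h, ← Finset.Nat.sum_antidiagonal_swap, Finset.Nat.sum_antidiagonal_eq_sum_range_succ_mk]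
  simp only [PowerSeries.coeff_mk, Polynomial.coeff_coe, Prod.swap]
  have h1 : ∑ j : Fin l, hp l ((k : ℤ) - ((l - 1 - (j : ℕ) : ℕ) : ℤ)) * (Pm l i).coeff (l - 1 - j)
     = ∑ m ∈ range l, hp l ((k : ℤ) - m) * (Pm l i).coeff m := by
    rw [← Finset.sum_range_reflect, Finset.sum_range]
  have h2 : ∑ m ∈ range l, hp l ((k : ℤ) - m) * (Pm l i).coeff m =
      ∑ m ∈ range (l + (k + 1)), hp l ((k : ℤ) - m) * (Pm l i).coeff m := by
    refine Finset.sum_subset (by intro x; simp; omega) ?_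
    intro m _ hm
    have := Pm_deg l i
    have := i.2
    rw [Polynomial.coeff_eq_zero_of_natDegree_lt, mul_zero]
    simp at hm
    omega
  have h3 : ∑ m ∈ range (k + 1), hsymm (Fin l) ℤ (k - m) * (Pm l i).coeff m =
      ∑ m ∈ range (l + (k + 1)), hp l ((k : ℤ) - m) * (Pm l i).coeff m := by
    refine Finset.sum_subset_zero_on_sdiff (by intro x; simp; omega) ?_ ?_
    · intro m hm
      simp at hm
      rw [hp, if_neg (by omega), zero_mul]
    · intro m hm
      simp at hm
      rw [hp, if_pos (by omega)]
      congr 2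
      omega
  rw [h1, h2, ← h3]

lemma altp_eq (l : ℕ) (A : Fin l → ℕ) : altp l (fun i => A i + (l - 1 - (i : ℕ))) = schur l A *
    Matrix.det (Matrix.of fun j i : Fin l => (Pm l i).coeff (l - 1 - j)) := by
  rw [schur, ← Matrix.det_mul, altp, ← Matrix.det_transpose]
  congr 1
  ext1 i j
  rw [Matrix.mul_apply, Matrix.transpose_apply, Matrix.of_apply, pow_eq]
  refine Finset.sum_congr rfl fun k _ => ?_
  simp only [Matrix.of_apply]
  congr 2
  have := k.2
  have := i.2
  omega

lemma schur_zero (l : ℕ) : schur l (fun _ => 0) = 1 := by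
  rw [schur, Matrix.det_of_isUpperTriangular]
  · simp [hp]
  · intro i j hij
    simp only [id] at hij
    have : (j : ℕ) < i := hij
    rw [Matrix.of_apply, hp, if_neg (by omega)]

lemma schur_mul_vdm (l : ℕ) (A : Fin l → ℕ) :
    schur l A * vdm l = altp l (fun i => A i + (l - 1 - (i : ℕ))) := by
  have h0 := altp_eq l (fun _ => 0)
  rw [schur_zero, one_mul] at h0
  rw [altp_eq, ← h0]
  simp [altp, vdm]

lemma schur_symm (l : ℕ) (A : Fin l → ℕ) : (schur l A).IsSymmetric := by
  intro e
  rw [schur, AlgHom.map_det]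
  congr 1
  ext1 i j
  simp only [AlgHom.mapMatrix_apply, Matrix.map_apply, Matrix.of_apply, hp]
  split_ifs
  · exact hsymm_isSymmetric _ _ _ e
  · simp

/-- Function to exponent vector. -/
noncomputable def fs {l : ℕ} (α : Fin l → ℕ) : Fin l →₀ ℕ := Finsupp.equivFunOnFinite.symm α

@[simp] lemma fs_apply {l : ℕ} (α : Fin l → ℕ) (i : Fin l) : fs α i = α i := rfl

lemma altp_expand (l : ℕ) (α : Fin l → ℕ) : altp l α =
    ∑ σ : Equiv.Perm (Fin l), monomial (fs (α ∘ σ.symm)) ((Equiv.Perm.sign σ : ℤˣ) : ℤ) := by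
  rw [altp, Matrix.det_apply']
  refine Finset.sum_congr rfl fun σ _ => ?_
  simp only [Matrix.of_apply]
  rw [← Equiv.prod_comp σ.symm, monomial_eq, Finsupp.prod_fintype _ _ (by simp)]
  simp

lemma coeff_symm {l : ℕ} {p : MvPolynomial (Fin l) ℤ} (hp : p.IsSymmetric) (β : Fin l → ℕ)
    (σ : Equiv.Perm (Fin l)) : coeff (fs (β ∘ σ)) p = coeff (fs β) p := by
  conv_rhs => rw [← hp σ]
  have : fs β = Finsupp.mapDomain σ (fs (β ∘ σ)) := by
    ext i
    rw [← Finsupp.equivMapDomain_eq_mapDomain]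
    simp
  rw [this, coeff_rename_mapDomain _ σ.injective]

lemma lex_lt_of {l : ℕ} {α β : Fin l → ℕ} (i : Fin l) (h : ∀ j < i, α j = β j) (hi : α i < β i) :
    MonomialOrder.lex.toSyn (fs α) < MonomialOrder.lex.toSyn (fs β) :=
  ⟨i, h, hi⟩

lemma lex_perm {l : ℕ} {α : Fin l → ℕ} (hα : StrictAnti α) (σ : Equiv.Perm (Fin l)) (hσ : σ ≠ 1) :
    MonomialOrder.lex.toSyn (fs (α ∘ σ)) < MonomialOrder.lex.toSyn (fs α) := by
  have hne : (univ.filter fun i => σ i ≠ i).Nonempty := by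
    by_contra h
    rw [Finset.not_nonempty_iff_eq_empty, Finset.filter_eq_empty_iff] at h
    exact hσ (Equiv.ext fun i => by simpa using h (Finset.mem_univ i))
  have hm := Finset.min'_mem _ hne
  set i := Finset.min' _ hne with hi
  have hlt : ∀ j < i, σ j = j := by
    intro j hj
    by_contra h
    exact absurd (Finset.min'_le _ j (by simpa using h)) (not_le.2 hj)
  simp only [Finset.mem_filter, Finset.mem_univ, true_and] at hm
  refine lex_lt_of i (fun j hj => by simp [hlt j hj]) (hα ?_)
  refine lt_of_le_of_ne (not_lt.1 fun h => ?_) (Ne.symm hm)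
  exact hm (σ.injective (hlt _ h))

lemma altp_coeff (l : ℕ) {α : Fin l → ℕ} (hα : StrictAnti α) : coeff (fs α) (altp l α) = 1 := by
  rw [altp_expand, coeff_sum, Finset.sum_eq_single 1]
  · simp
    rfl
  · intro σ _ hσ
    rw [coeff_monomial, if_neg]
    intro h
    have := lex_perm hα σ⁻¹ (by simpa using hσ)
    exact this.ne (congrArg _ h)
  · simp

lemma altp_degree (l : ℕ) {α : Fin l → ℕ} (hα : StrictAnti α) :
    MonomialOrder.lex.degree (altp l α) = fs α := by
  apply MonomialOrder.lex.toSyn.injective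
  apply le_antisymm
  · rw [altp_expand]
    refine MonomialOrder.degree_sum_le.trans ?_
    rw [Finset.sup_le_iff]
    intro σ _
    refine MonomialOrder.degree_monomial_le _ |>.trans ?_
    by_cases h : σ = 1
    · subst h; exact le_rfl
    · exact (lex_perm hα σ⁻¹ (by simpa using h)).le
  · apply MonomialOrder.le_degree
    rw [mem_support_iff, altp_coeff l hα]
    exact one_ne_zero

lemma strictAnti_add {l : ℕ} {A : Fin l → ℕ} (hA : Antitone A) :
    StrictAnti (fun i => A i + (l - 1 - (i : ℕ))) := by
  intro i j hij
  have h1 := hA hij.le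
  have h2 : (i : ℕ) < j := hij
  have := j.2
  simp only
  omega

lemma vdm_eq (l : ℕ) : vdm l = altp l (fun i => 0 + (l - 1 - (i : ℕ))) := by
  simp [altp, vdm]

lemma schur_degree (l : ℕ) {A : Fin l → ℕ} (hA : Antitone A) :
    MonomialOrder.lex.degree (schur l A) = fs A ∧ coeff (fs A) (schur l A) = 1 := by
  have hδ := strictAnti_add (l := l) (A := fun _ => 0) (fun _ _ _ => le_rfl)
  have hAδ := strictAnti_add hA
  have hne : schur l A * vdm l ≠ 0 := by
    rw [schur_mul_vdm]
    intro h
    have := altp_coeff l hAδ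
    rw [h] at this
    simp at this
  have hd := MonomialOrder.degree_mul' (m := MonomialOrder.lex) hne
  rw [schur_mul_vdm, vdm_eq, altp_degree l hAδ, altp_degree l hδ] at hd
  have hd' : MonomialOrder.lex.degree (schur l A) = fs A := by
    ext i
    have := DFunLike.congr_fun hd i
    simp at this
    rw [fs_apply, this]
  refine ⟨hd', ?_⟩
  have hc := MonomialOrder.leadingCoeff_mul (m := MonomialOrder.lex) (f := schur l A) (g := vdm l)
  rw [schur_mul_vdm, vdm_eq] at hc
  unfold MonomialOrder.leadingCoeff at hc
  rw [altp_degree l hAδ, altp_degree l hδ, altp_coeff l hAδ, altp_coeff l hδ, hd', mul_one] at hc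
  exact hc.symm

/-- If `A`, `B` are partitions of length at most `l` such that the tuple
`A + χ(B)`, with `i`-th entry `a_i - b_{l+1-i}`, is again a partition (nonnegative and
weakly decreasing), then the Littlewood–Richardson coefficient `c^{A}_{A+χ(B), B}` is
positive. -/
theorem lrCoeff_pos_chi (l : ℕ) (A B : Fin l → ℕ) (hA : Antitone A) (hB : Antitone B)
    (hnonneg : ∀ i : Fin l, B (Fin.rev i) ≤ A i)
    (hmono : Antitone fun i : Fin l => A i - B (Fin.rev i)) :
    0 < lrCoeff l (fun i => A i - B (Fin.rev i)) B A := by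
  set L : Fin l → ℕ := fun i => A i - B (Fin.rev i) with hL
  suffices h : lrCoeff l L B A = 1 by rw [h]; exact one_pos
  have hLA : ∀ i, L i + B (Fin.rev i) = A i := fun i => Nat.sub_add_cancel (hnonneg i)
  have hN := strictAnti_add hA
  set N : Fin l → ℕ := fun i => A i + (l - 1 - (i : ℕ)) with hNdef
  set α : Fin l → ℕ := fun i => L i + (l - 1 - (i : ℕ)) with hα
  have hαN : ∀ i, α i + B (Fin.rev i) = N i := fun i => by
    have := hLA i
    simp only [hα, hNdef]
    omega
  have h1 : lrCoeff l L B A = coeff (fs N) (schur l B * altp l α) := by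
    rw [lrCoeff, schurMult, mul_comm (schur l L), mul_assoc, schur_mul_vdm]
    rfl
  obtain ⟨hdeg, hlead⟩ := schur_degree l hB
  rw [h1, altp_expand, Finset.mul_sum, coeff_sum, Finset.sum_eq_single 1]
  · have h2 : fs N = fs (B ∘ Fin.revPerm) + fs (α ∘ (1 : Equiv.Perm (Fin l)).symm) := by
      ext i
      exact (hαN i).symm.trans (add_comm _ _)
    rw [h2, coeff_mul_monomial, coeff_symm (schur_symm l B), hlead]
    simp
  · intro σ _ hσ
    rw [coeff_mul_monomial']
    split_ifs with hle
    · rw [mul_eq_zero]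
      left
      set γ : Fin l → ℕ := fun i => N i - α (σ.symm i) with hγ
      have hγ2 : fs N - fs (α ∘ σ.symm) = fs γ := by
        ext i; simp [hγ]
      have hγ3 : ∀ i, γ (σ i) + α i = N (σ i) := by
        intro i
        have := hle (σ i)
        simp at this
        simp only [hγ, Equiv.symm_apply_apply]
        omega
      rw [hγ2, ← coeff_symm (schur_symm l B) γ σ,
        ← coeff_symm (schur_symm l B) (γ ∘ σ) Fin.revPerm]
      apply MonomialOrder.coeff_eq_zero_of_lt (m := MonomialOrder.lex)
      rw [hdeg]
      have hne : (univ.filter fun i => σ i ≠ i).Nonempty := by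
        by_contra h
        rw [Finset.not_nonempty_iff_eq_empty, Finset.filter_eq_empty_iff] at h
        exact hσ (Equiv.ext fun i => by simpa using h (Finset.mem_univ i))
      have hm := Finset.max'_mem _ hne
      set i := Finset.max' _ hne with hi
      have hgt : ∀ j, i < j → σ j = j := by
        intro j hj
        by_contra h
        exact absurd (Finset.le_max' _ j (by simpa using h)) (not_le.2 hj)
      simp only [Finset.mem_filter, Finset.mem_univ, true_and] at hm
      have hlt : σ i < i := by
        refine lt_of_le_of_ne (not_lt.1 fun h => ?_) hm
        exact hm (σ.injective (hgt _ h))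
      refine lex_lt_of (Fin.rev i) (fun j hj => ?_) ?_
      · have e1 := hgt (Fin.rev j) (by rwa [Fin.lt_rev_iff])
        have e2 := hγ3 (Fin.rev j)
        have e3 := hαN (Fin.rev j)
        rw [Fin.rev_rev] at e3
        rw [e1] at e2
        simp only [Function.comp, Fin.revPerm_apply, e1]
        omega
      · have e2 := hγ3 i
        have e3 := hαN i
        have e4 := hN hlt
        simp only [Function.comp, Fin.revPerm_apply, Fin.rev_rev]
        change N i < N (σ i) at e4
        omega
    · rfl
  · simp
end

section
/- Let A be a partition of length at most l with weight w. Then (i) the rectangular partition wD(l) = (w, w, …, w) with l entries has positive multiplicity in the l-th power (s_A)^l of the Schur function of A, and (ii) the partition wD(l) + χ(A) = (w − a_l, w − a_{l−1}, …, w − a_1) has positive multiplicity in (s_A)^{l−1}. -/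
open Finset MvPolynomial

/-- The alternant with exponents `α`. -/
noncomputable def alt (n : ℕ) (α : Fin n → ℕ) : MvPolynomial (Fin n) ℤ :=
  Matrix.det (Matrix.of fun i j : Fin n => (X i : MvPolynomial (Fin n) ℤ) ^ (α j))

noncomputable def geo_s7 (n : ℕ) (i : Fin n) : PowerSeries (MvPolynomial (Fin n) ℤ) :=
  PowerSeries.mk fun m => X i ^ m

noncomputable def lin (n : ℕ) (i : Fin n) : PowerSeries (MvPolynomial (Fin n) ℤ) :=
  1 - PowerSeries.C (X i) * PowerSeries.X

lemma geo_mul_lin (n : ℕ) (i : Fin n) : geo_s7 n i * lin n i = 1 := by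
  ext1 m
  rw [lin, mul_sub, mul_one, mul_left_comm, ← mul_assoc]
  cases m with
  | zero => simp [geo_s7]
  | succ m =>
    simp [geo_s7, PowerSeries.coeff_succ_mul_X, PowerSeries.coeff_C_mul, pow_succ', PowerSeries.coeff_one]

lemma hsymm_eq_coeff (n m : ℕ) :
    hsymm (Fin n) ℤ m = PowerSeries.coeff m (∏ i, geo_s7 n i) := by
  rw [PowerSeries.coeff_prod, hsymm]
  simp only [geo_s7, PowerSeries.coeff_mk]
  rw [← Finset.sum_coe_sort (finsuppAntidiag univ m)]
  refine Fintype.sum_equiv ((Sym.equivNatSum (Fin n) m).trans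
    (Equiv.subtypeEquivRight fun P => ?_)) _ _ ?_
  · rw [Finset.mem_finsuppAntidiag]
    simp [Finsupp.sum_fintype]
  · intro s
    rw [Finset.prod_multiset_map_count]
    refine Finset.prod_subset (Finset.subset_univ _) ?_
    intro x _ hx
    rw [Multiset.mem_toFinset] at hx
    rw [Multiset.count_eq_zero_of_notMem hx, pow_zero]

lemma prod_lin_erase (n : ℕ) (i : Fin n) :
    (∏ j, geo_s7 n j) * (∏ j ∈ univ.erase i, lin n j) = geo_s7 n i := by
  have h : (∏ j, geo_s7 n j) = geo_s7 n i * ∏ j ∈ univ.erase i, geo_s7 n j :=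
    (Finset.mul_prod_erase _ _ (Finset.mem_univ i)).symm
  rw [h, mul_assoc, ← Finset.prod_mul_distrib]
  simp [geo_mul_lin]

/-- Coefficients of the product of the linear factors different from `i`. -/
noncomputable def cc (n : ℕ) (i : Fin n) (r : ℕ) : MvPolynomial (Fin n) ℤ :=
  PowerSeries.coeff r (∏ j ∈ univ.erase i, lin n j)

lemma coeff_prod_lin (n : ℕ) (s : Finset (Fin n)) (r : ℕ) (hr : s.card < r) :
    PowerSeries.coeff r (∏ j ∈ s, lin n j) = 0 := by
  classical
  induction s using Finset.induction_on generalizing r with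
  | empty =>
    simp at hr
    simp [PowerSeries.coeff_one, hr.ne']
  | insert a s ha ih =>
    rw [Finset.prod_insert ha, lin, sub_mul, one_mul, map_sub]
    rw [Finset.card_insert_of_notMem ha] at hr
    obtain ⟨r, rfl⟩ : ∃ r', r = r' + 1 := ⟨r - 1, by omega⟩
    rw [ih _ (by omega), mul_assoc, PowerSeries.coeff_C_mul, PowerSeries.coeff_succ_X_mul,
      ih _ (by omega)]
    simp

lemma pow_eq_sum (n : ℕ) (i : Fin n) (m : ℕ) :
    (X i : MvPolynomial (Fin n) ℤ) ^ m =
      ∑ k : Fin n, cc n i (n - 1 - k) * hp n ((m : ℤ) - (n - 1 : ℕ) + (k : ℕ)) := by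
  have h1 : (X i : MvPolynomial (Fin n) ℤ) ^ m = PowerSeries.coeff m (geo_s7 n i) := by
    simp [geo_s7]
  have hn : 0 < n := i.pos
  have h2 : ∑ k : Fin n, cc n i (n - 1 - k) * hp n ((m : ℤ) - (n - 1 : ℕ) + (k : ℕ)) =
      ∑ r ∈ range n, cc n i r * hp n ((m : ℤ) - (r : ℕ)) := by
    rw [← Fin.sum_univ_eq_sum_range (fun r => cc n i r * hp n ((m : ℤ) - (r : ℕ))) n,
      ← Equiv.sum_comp Fin.revPerm]
    refine Finset.sum_congr rfl fun k _ => ?_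
    have hk := k.isLt
    simp only [Fin.revPerm_apply, Fin.val_rev]
    congr 2
    · omega
    · omega
  have h3 : ∀ r, n ≤ r → cc n i r = 0 := by
    intro r hr
    apply coeff_prod_lin
    rw [Finset.card_erase_of_mem (Finset.mem_univ i), Finset.card_univ, Fintype.card_fin]
    omega
  rw [h1, h2, ← prod_lin_erase, mul_comm, PowerSeries.coeff_mul,
    Finset.Nat.sum_antidiagonal_eq_sum_range_succ_mk]
  have h4 : ∑ r ∈ range n, cc n i r * hp n ((m : ℤ) - (r : ℕ)) =
      ∑ r ∈ range (n + (m + 1)), cc n i r * hp n ((m : ℤ) - (r : ℕ)) := by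
    refine Finset.sum_subset (fun x hx => ?_) fun x _ hx => ?_
    · simp at hx ⊢; omega
    · simp at hx
      rw [h3 x hx, zero_mul]
  rw [h4]
  rw [← Finset.sum_subset (s₁ := range (m + 1)) (s₂ := range (n + (m + 1)))]
  · refine Finset.sum_congr rfl fun r hr => ?_
    simp only [Finset.mem_range] at hr
    have : ((m : ℤ) - r).toNat = m - r := by omega
    rw [hp, if_pos (by omega), this, hsymm_eq_coeff]
    rfl
  · intro x hx; simp at hx ⊢; omega
  · intro x _ hx
    simp at hx
    rw [hp, if_neg (by omega), mul_zero]

/-- The exponent vector `B + δ`. -/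
def shift (n : ℕ) (B : Fin n → ℕ) : Fin n → ℕ := fun i => B i + (n - 1 - (i : ℕ))

lemma alt_shift (n : ℕ) (B : Fin n → ℕ) :
    alt n (shift n B) =
      Matrix.det (Matrix.of fun i k : Fin n => cc n i (n - 1 - k)) * schur n B := by
  rw [schur, ← Matrix.det_transpose (Matrix.of fun i j : Fin n => hp n _), ← Matrix.det_mul, alt]
  congr 1
  ext1 i j
  rw [Matrix.mul_apply, Matrix.of_apply, pow_eq_sum]
  refine Finset.sum_congr rfl fun k _ => ?_
  have hj := j.isLt
  simp only [Matrix.of_apply, Matrix.transpose_apply, shift]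
  congr 2
  omega

lemma schur_zero_s7 (n : ℕ) : schur n 0 = 1 := by
  rw [schur, Matrix.det_of_isUpperTriangular]
  · simp [hp]
  · intro i j hij
    simp only [id] at hij
    have : (j : ℕ) < i := hij
    simp only [Matrix.of_apply, hp]
    rw [if_neg]
    simp
    omega

lemma vdm_eq_s7 (n : ℕ) : vdm n = alt n (shift n 0) := by
  simp [vdm, alt, shift]

lemma schur_mul_vdm_s7 (n : ℕ) (B : Fin n → ℕ) :
    schur n B * vdm n = alt n (shift n B) := by
  rw [vdm_eq_s7, alt_shift, alt_shift, schur_zero_s7]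
  ring

lemma alt_eq_sum (n : ℕ) (α : Fin n → ℕ) :
    alt n α = ∑ σ : Equiv.Perm (Fin n), (Equiv.Perm.sign σ : ℤ) •
      rename σ (∏ i, (X i : MvPolynomial (Fin n) ℤ) ^ α i) := by
  rw [alt, Matrix.det_apply]
  refine Finset.sum_congr rfl fun σ _ => ?_
  simp [map_prod, Units.smul_def]

lemma alt_mul (n : ℕ) (α : Fin n → ℕ) {ι : Type*} (s : Finset ι) (w : ι → Fin n → ℕ)
    (P : MvPolynomial (Fin n) ℤ) (hP : P = ∑ t ∈ s, ∏ i, X i ^ w t i)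
    (hs : ∀ σ : Equiv.Perm (Fin n), rename σ P = P) :
    alt n α * P = ∑ t ∈ s, alt n (α + w t) := by
  simp only [alt_eq_sum n]
  rw [Finset.sum_mul, Finset.sum_comm]
  refine Finset.sum_congr rfl fun σ _ => ?_
  rw [← Finset.smul_sum, smul_mul_assoc]
  congr 1
  conv_lhs => rw [← hs σ, ← map_mul, hP, Finset.mul_sum]
  rw [map_sum]
  refine Finset.sum_congr rfl fun t _ => ?_
  simp only [Pi.add_apply, pow_add, Finset.prod_mul_distrib]

lemma alt_perm (n : ℕ) (α : Fin n → ℕ) (σ : Equiv.Perm (Fin n)) :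
    alt n (α ∘ σ) = (Equiv.Perm.sign σ : ℤ) • alt n α := by
  have := Matrix.det_permute' σ (Matrix.of fun i j : Fin n => (X i : MvPolynomial (Fin n) ℤ) ^ (α j))
  rw [alt, alt, zsmul_eq_mul]
  exact this

lemma coeff_alt (n : ℕ) (α β : Fin n → ℕ) (hα : StrictAnti α) (hβ : StrictAnti β) :
    coeff (Finsupp.equivFunOnFinite.symm β) (alt n α) = if α = β then 1 else 0 := by
  have key : ∀ σ : Equiv.Perm (Fin n),
      coeff (Finsupp.equivFunOnFinite.symm β)
        (rename σ (∏ i, (X i : MvPolynomial (Fin n) ℤ) ^ α i)) =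
      if β ∘ σ = α then 1 else 0 := by
    intro σ
    have h : rename σ (∏ i, (X i : MvPolynomial (Fin n) ℤ) ^ α i) =
        monomial (Finsupp.equivFunOnFinite.symm (α ∘ σ.symm)) 1 := by
      rw [monomial_eq, Finsupp.prod_fintype _ _ (by simp)]
      simp only [map_prod, map_pow, rename_X, map_one, one_mul]
      conv_rhs => rw [← Equiv.prod_comp σ]
      simp
    rw [h, coeff_monomial]
    refine if_congr ?_ rfl rfl
    rw [Equiv.apply_eq_iff_eq]
    constructor
    · intro h; rw [← h]; ext; simp
    · intro h; rw [← h]; ext; simp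
  rw [alt_eq_sum, coeff_sum]
  simp only [coeff_smul, key]
  have h1 : ∀ σ : Equiv.Perm (Fin n), β ∘ σ = α ↔ σ = 1 ∧ α = β := by
    intro σ
    constructor
    · intro h
      have hm : StrictMono σ := by
        intro a b hab
        have := hα hab
        rw [← h] at this
        exact hβ.lt_iff_gt.1 this
      have : σ = 1 := by
        ext i
        have := Subsingleton.elim (hm.orderIsoOfSurjective _ σ.surjective) (OrderIso.refl _)
        have h2 := congrArg (fun e : Fin n ≃o Fin n => e i) this
        simpa using congrArg Fin.val h2
      subst this
      exact ⟨rfl, by rw [← h]; rfl⟩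
    · rintro ⟨rfl, rfl⟩; rfl
  simp only [h1]
  by_cases hab : α = β
  · simp [hab]
  · simp [hab]

lemma shift_strictAnti (n : ℕ) (B : Fin n → ℕ) (hB : Antitone B) : StrictAnti (shift n B) := by
  intro a b hab
  have := hB hab.le
  have h2 : (a : ℕ) < b := hab
  have := b.isLt
  simp only [shift]
  omega

lemma vdm_ne_zero (n : ℕ) : vdm n ≠ 0 := by
  intro h
  have h0 := shift_strictAnti n 0 (fun _ _ _ => le_rfl)
  have := coeff_alt n _ _ h0 h0
  rw [← vdm_eq_s7, h] at this
  simp at this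

/-- Gelfand–Tsetlin patterns with top row `A`. -/
structure IsGT (n : ℕ) (A : ℕ → ℕ) (p : ℕ → ℕ → ℕ) : Prop where
  zero : ∀ s, p 0 s = 0
  up : ∀ r s, p r s ≤ p (r + 1) s
  dn : ∀ r s, p (r + 1) (s + 1) ≤ p r s
  top : ∀ r s, n ≤ r → p r s = A s

/-- Number of boxes in columns `≥ j` with letters `< r`. -/
def U (n : ℕ) (p : ℕ → ℕ → ℕ) (r j : ℕ) : ℕ := ∑ s ∈ range n, (p r s - j)

/-- The weight of a pattern. -/
def wt (n : ℕ) (p : ℕ → ℕ → ℕ) (i : Fin n) : ℕ := U n p (i + 1) 0 - U n p i 0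

namespace IsGT

variable {n : ℕ} {A : ℕ → ℕ} {p : ℕ → ℕ → ℕ}

lemma eq_zero (h : IsGT n A p) (r s : ℕ) (hs : r ≤ s) : p r s = 0 := by
  induction r generalizing s with
  | zero => exact h.zero s
  | succ r ih =>
    obtain ⟨s, rfl⟩ : ∃ t, s = t + 1 := ⟨s - 1, by omega⟩
    have := h.dn r s
    have := ih s (by omega)
    omega

lemma mono (h : IsGT n A p) (s : ℕ) : Monotone fun r => p r s :=
  monotone_nat_of_le_succ fun r => h.up r s

lemma anti (h : IsGT n A p) (r : ℕ) : Antitone (p r) :=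
  antitone_nat_of_succ_le fun s => (h.up r (s + 1)).trans (h.dn r s)

lemma le_top (h : IsGT n A p) (r s : ℕ) : p r s ≤ A s := by
  rcases le_total n r with hr | hr
  · exact (h.top r s hr).le
  · exact (h.mono s hr).trans (h.top n s le_rfl).le

lemma le_A (h : IsGT n A p) (r s : ℕ) : p r s ≤ A 0 :=
  (h.anti r (Nat.zero_le s)).trans (h.le_top r 0)

lemma U_mono (h : IsGT n A p) (r j : ℕ) : U n p r j ≤ U n p (r + 1) j :=
  Finset.sum_le_sum fun s _ => Nat.sub_le_sub_right (h.up r s) j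

lemma U_large (h : IsGT n A p) (r j : ℕ) (hj : A 0 ≤ j) : U n p r j = 0 := by
  refine Finset.sum_eq_zero fun s _ => ?_
  have := h.le_A r s
  omega

end IsGT

lemma gt_finite (n : ℕ) (A : ℕ → ℕ) : {p | IsGT n A p}.Finite := by
  refine Set.Finite.of_injOn (f := fun p => fun x : Fin n × Fin n => p x.1 x.2)
    (t := {g | ∀ x, g x ∈ Set.Iic (A 0)}) ?_ ?_ (Set.Finite.pi' fun _ => Set.finite_Iic _)
  · intro p hp x
    exact hp.le_A _ _
  · intro p hp q hq hpq
    ext r s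
    rcases le_or_gt n r with hr | hr
    · rw [hp.top r s hr, hq.top r s hr]
    · rcases le_or_gt r s with hs | hs
      · rw [hp.eq_zero r s hs, hq.eq_zero r s hs]
      · exact congrFun hpq (⟨r, hr⟩, ⟨s, by omega⟩)

noncomputable def gts (n : ℕ) (A : ℕ → ℕ) : Finset (ℕ → ℕ → ℕ) := (gt_finite n A).toFinset

lemma mem_gts {n : ℕ} {A : ℕ → ℕ} {p : ℕ → ℕ → ℕ} : p ∈ gts n A ↔ IsGT n A p := by
  simp [gts]

/-- Upper bound for the entries of row `m + 1`. -/
def hi (p : ℕ → ℕ → ℕ) (m : ℕ) : ℕ → ℕ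
  | 0 => p (m + 2) 0
  | s + 1 => min (p (m + 2) (s + 1)) (p m s)

/-- Bender–Knuth reflection of row `m + 1`, restricted to the first `j` columns. -/
def bk (j m : ℕ) (p : ℕ → ℕ → ℕ) : ℕ → ℕ → ℕ := fun r s =>
  if r = m + 1 then
    if j < p r s then p r s
    else max (p (m + 2) (s + 1)) (p m s) + min j (hi p m s) - p r s
  else p r s

lemma bk_ne (j m : ℕ) (p : ℕ → ℕ → ℕ) (r s : ℕ) (h : r ≠ m + 1) : bk j m p r s = p r s := by
  simp [bk, h]

lemma hi_bk (j m : ℕ) (p : ℕ → ℕ → ℕ) (s : ℕ) : hi (bk j m p) m s = hi p m s := by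
  cases s <;> simp [hi, bk]

lemma U_bk_ne (n j m : ℕ) (p : ℕ → ℕ → ℕ) (r j' : ℕ) (h : r ≠ m + 1) :
    U n (bk j m p) r j' = U n p r j' := by
  simp [U, bk_ne, h]

section
variable {n : ℕ} {A : ℕ → ℕ} {p : ℕ → ℕ → ℕ}

lemma lo_le (h : IsGT n A p) (m s : ℕ) : max (p (m + 2) (s + 1)) (p m s) ≤ p (m + 1) s :=
  max_le (h.dn _ _) (h.up _ _)

lemma le_hi (h : IsGT n A p) (m s : ℕ) : p (m + 1) s ≤ hi p m s := by
  cases s with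
  | zero => exact h.up _ _
  | succ s => exact le_min (h.up _ _) (h.dn _ _)

lemma bk_bounds (h : IsGT n A p) (j m s : ℕ) :
    max (p (m + 2) (s + 1)) (p m s) ≤ bk j m p (m + 1) s ∧ bk j m p (m + 1) s ≤ hi p m s ∧
    (j < bk j m p (m + 1) s ↔ j < p (m + 1) s) ∧
    (p (m + 1) s ≤ j → bk j m p (m + 1) s + p (m + 1) s =
      max (p (m + 2) (s + 1)) (p m s) + min j (hi p m s)) ∧
    (j < p (m + 1) s → bk j m p (m + 1) s = p (m + 1) s) := by
  have h1 := lo_le h m s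
  have h2 := le_hi h m s
  simp only [bk, if_true]
  split_ifs with h3 <;> omega

lemma bk_isGT (h : IsGT n A p) (j m : ℕ) (hm : m + 1 < n) : IsGT n A (bk j m p) where
  zero s := by rw [bk_ne _ _ _ _ _ (by omega)]; exact h.zero s
  up r s := by
    by_cases h1 : r = m + 1
    · subst h1
      rw [bk_ne _ _ _ (m + 1 + 1) _ (by omega)]
      refine (bk_bounds h j m s).2.1.trans ?_
      cases s with
      | zero => exact le_rfl
      | succ s => exact min_le_left _ _
    · rw [bk_ne _ _ _ _ _ h1]
      by_cases h2 : r = m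
      · subst h2
        exact (le_max_right _ _).trans (bk_bounds h j r s).1
      · rw [bk_ne _ _ _ _ _ (by omega)]
        exact h.up r s
  dn r s := by
    by_cases h1 : r = m + 1
    · subst h1
      rw [bk_ne _ _ _ (m + 1 + 1) _ (by omega)]
      exact (le_max_left _ _).trans (bk_bounds h j m s).1
    · rw [bk_ne _ _ _ r _ h1]
      by_cases h2 : r = m
      · subst h2
        exact (bk_bounds h j r (s + 1)).2.1.trans (min_le_right _ _)
      · rw [bk_ne _ _ _ _ _ (by omega)]
        exact h.dn r s
  top r s hr := by rw [bk_ne _ _ _ _ _ (by omega)]; exact h.top r s hr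

lemma bk_bk (h : IsGT n A p) (j m : ℕ) (hm : m + 1 < n) : bk j m (bk j m p) = p := by
  ext r s
  by_cases h1 : r = m + 1
  · subst h1
    have a := bk_bounds h j m s
    have b := bk_bounds (bk_isGT h j m hm) j m s
    rw [hi_bk, bk_ne _ _ _ (m + 2) _ (by omega), bk_ne _ _ _ m _ (by omega)] at b
    omega
  · rw [bk_ne _ _ _ _ _ h1, bk_ne _ _ _ _ _ h1]

lemma U_bk (h : IsGT n A p) (j m r j' : ℕ) (hj : j ≤ j') :
    U n (bk j m p) r j' = U n p r j' := by
  by_cases h1 : r = m + 1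
  · subst h1
    refine Finset.sum_congr rfl fun s _ => ?_
    have := bk_bounds h j m s
    omega
  · exact U_bk_ne n j m p r j' h1

lemma sum_lo_hi (j m : ℕ) (N : ℕ) :
    ∑ s ∈ range N, (min j (max (p (m + 2) (s + 1)) (p m s)) + min j (hi p m s))
      + min j (hi p m N) =
    ∑ s ∈ range N, (min j (p (m + 2) s) + min j (p m s)) + min j (p (m + 2) N) := by
  induction N with
  | zero => simp [hi]
  | succ N ih =>
    rw [Finset.sum_range_succ, Finset.sum_range_succ]
    have : hi p m (N + 1) = min (p (m + 2) (N + 1)) (p m N) := rfl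
    omega

lemma U_split (r j : ℕ) : U n p r 0 = U n p r j + ∑ s ∈ range n, min j (p r s) := by
  rw [U, U, ← Finset.sum_add_distrib]
  refine Finset.sum_congr rfl fun s _ => ?_
  omega

lemma U_bk_add (h : IsGT n A p) (j m : ℕ) (hm : m + 1 < n)
    (hj : ∀ s, j < p (m + 1) s → j < p m s) :
    U n p (m + 1) 0 + U n (bk j m p) (m + 1) 0 + (U n p (m + 2) j + U n p m j) =
      U n p (m + 2) 0 + U n p m 0 + 2 * U n p (m + 1) j := by
  have h1 : U n p (m + 1) 0 + U n (bk j m p) (m + 1) 0 =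
      2 * U n p (m + 1) j +
      ∑ s ∈ range n, (min j (max (p (m + 2) (s + 1)) (p m s)) + min j (hi p m s)) := by
    simp only [U, Finset.mul_sum, ← Finset.sum_add_distrib]
    refine Finset.sum_congr rfl fun s _ => ?_
    have a := bk_bounds h j m s
    have b := hj s
    have c := lo_le h m s
    have d := le_hi h m s
    omega
  have h2 := sum_lo_hi (p := p) j m n
  have h3 : p (m + 2) n = 0 := h.eq_zero _ _ (by omega)
  have h4 : hi p m n = 0 := by
    obtain ⟨k, rfl⟩ : ∃ k, n = k + 1 := ⟨n - 1, by omega⟩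
    simp [hi, h3]
  rw [h3, h4, Finset.sum_add_distrib (f := fun s => min j (p (m + 2) s))] at h2
  have h5 := U_split (n := n) (p := p) (m + 2) j
  have h6 := U_split (n := n) (p := p) m j
  omega

/-- number of boxes in column `j` with letters `< r` -/
def u (n : ℕ) (p : ℕ → ℕ → ℕ) (r j : ℕ) : ℕ := ∑ s ∈ range n, if j < p r s then 1 else 0

lemma u_succ_n (n : ℕ) (p : ℕ → ℕ → ℕ) (r j : ℕ) :
    u (n + 1) p r j = u n p r j + if j < p r n then 1 else 0 :=
  Finset.sum_range_succ _ _

lemma U_succ (r j : ℕ) : U n p r j = U n p r (j + 1) + u n p r j := by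
  rw [U, U, u, ← Finset.sum_add_distrib]
  refine Finset.sum_congr rfl fun s _ => ?_
  split_ifs <;> omega

lemma u_mono (h : IsGT n A p) (r j : ℕ) : u n p r j ≤ u n p (r + 1) j := by
  refine Finset.sum_le_sum fun s _ => ?_
  have := h.up r s
  split_ifs <;> omega

lemma u_succ_le (h : IsGT n A p) (r j : ℕ) : u n p (r + 1) j ≤ u n p r j + 1 := by
  have key : ∀ N, u (N + 1) p (r + 1) j ≤ u N p r j + 1 := by
    intro N
    induction N with
    | zero => rw [u_succ_n]; simp only [u, Finset.range_zero, Finset.sum_empty]; split_ifs <;> omega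
    | succ N ih =>
      have := h.dn r N
      rw [u_succ_n (N + 1), u_succ_n N p r]
      split_ifs <;> omega
  refine le_trans ?_ (key n)
  rw [u, u, Finset.sum_range_succ]
  omega

/-- The pattern violates the dominance condition at columns `≥ j`, letters `m, m+1`. -/
def Bad (n : ℕ) (B : ℕ → ℕ) (p : ℕ → ℕ → ℕ) (j m : ℕ) : Prop :=
  m + 1 < n ∧ B m + 2 * U n p (m + 1) j < B (m + 1) + U n p (m + 2) j + U n p m j

/-- `(j, m)` is the first violation. -/
def Cls (n : ℕ) (B : ℕ → ℕ) (p : ℕ → ℕ → ℕ) (j m : ℕ) : Prop :=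
  Bad n B p j m ∧ (∀ j' m', j < j' → ¬ Bad n B p j' m') ∧ (∀ m', m' < m → ¬ Bad n B p j m')

lemma exists_cls {B : ℕ → ℕ} (hB : Antitone B) (h : IsGT n A p) (hb : ∃ j m, Bad n B p j m) :
    ∃ j m, Cls n B p j m := by
  classical
  have hlarge : ∀ j m, Bad n B p j m → j ≤ A 0 := by
    intro j m hbad
    by_contra hj
    have h1 := hbad.2
    rw [h.U_large _ _ (by omega), h.U_large _ _ (by omega), h.U_large _ _ (by omega)] at h1
    have : B (m + 1) ≤ B m := hB (Nat.le_succ m)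
    simp at h1
    omega
  obtain ⟨j0, m0, h0⟩ := hb
  let P := fun j => ∃ m, Bad n B p j m
  have hP : P (Nat.findGreatest P (A 0)) :=
    Nat.findGreatest_spec (P := P) (hlarge j0 m0 h0) ⟨m0, h0⟩
  refine ⟨Nat.findGreatest P (A 0), Nat.find hP, Nat.find_spec hP, ?_, ?_⟩
  · intro j' m' hj hbad
    exact Nat.findGreatest_is_greatest hj (hlarge _ _ hbad) ⟨m', hbad⟩
  · intro m' hm'
    exact Nat.find_min hP hm'

lemma cls_unique {B : ℕ → ℕ} {j m j' m' : ℕ} (h : Cls n B p j m) (h' : Cls n B p j' m') :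
    j = j' ∧ m = m' := by
  have hj : j = j' := by
    rcases lt_trichotomy j j' with hh | hh | hh
    · exact absurd h'.1 (h.2.1 _ _ hh)
    · exact hh
    · exact absurd h.1 (h'.2.1 _ _ hh)
  subst hj
  refine ⟨rfl, ?_⟩
  rcases lt_trichotomy m m' with hh | hh | hh
  · exact absurd h.1 (h'.2.2 _ hh)
  · exact hh
  · exact absurd h'.1 (h.2.2 _ hh)

lemma cls_bk {B : ℕ → ℕ} {j m : ℕ} (h : IsGT n A p) (hc : Cls n B p j m) :
    Cls n B (bk j m p) j m := by
  have key : ∀ j' m', j ≤ j' → (Bad n B (bk j m p) j' m' ↔ Bad n B p j' m') := by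
    intro j' m' hj
    simp only [Bad, U_bk h j m _ j' hj]
  refine ⟨(key j m le_rfl).2 hc.1, fun j' m' hj => ?_, fun m' hm => ?_⟩
  · rw [key j' m' hj.le]; exact hc.2.1 _ _ hj
  · rw [key j m' le_rfl]; exact hc.2.2 _ hm

lemma cls_eq {B : ℕ → ℕ} {j m : ℕ} (h : IsGT n A p) (hc : Cls n B p j m) :
    B m + U n p (m + 1) 0 + U n (bk j m p) (m + 1) 0 + 1 =
      B (m + 1) + U n p (m + 2) 0 + U n p m 0 := by
  have h1 := hc.1.2
  have hm := hc.1.1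
  have h2 := hc.2.1 (j + 1) m (by omega)
  simp only [Bad, not_and, not_lt] at h2
  have h2 := h2 hm
  have a0 := U_succ (n := n) (p := p) m j
  have a1 := U_succ (n := n) (p := p) (m + 1) j
  have a2 := U_succ (n := n) (p := p) (m + 2) j
  have b1 := u_mono h m j
  have b2 := u_succ_le h (m + 1) j
  have b2 : u n p (m + 2) j ≤ u n p (m + 1) j + 1 := b2
  have e1 : u n p m j = u n p (m + 1) j := by omega
  have hj : ∀ s, j < p (m + 1) s → j < p m s := by
    intro s hs
    have hsn : s < n := by
      by_contra hsn
      rw [h.eq_zero _ _ (by omega)] at hs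
      omega
    have := (Finset.sum_eq_sum_iff_of_le (s := range n) (fun s _ => ?_)).1 e1 s (by simpa using hsn)
    · rw [if_pos hs] at this
      by_contra hn
      simp [hn] at this
    · have := h.up m s
      split_ifs <;> omega
  have := U_bk_add h j m hm hj
  omega

end

lemma eq_comp_swap {n : ℕ} (f g : Fin n → ℕ) (a b : Fin n) (h1 : g a = f b) (h2 : g b = f a)
    (h3 : ∀ i, i ≠ a → i ≠ b → g i = f i) : g = f ∘ Equiv.swap a b := by
  ext i
  by_cases ha : i = a
  · subst ha; simp [h1]
  · by_cases hb : i = b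
    · subst hb; simp [h2]
    · simp [Equiv.swap_apply_of_ne_of_ne ha hb, h3 i ha hb]

lemma wt_bk_ne {n : ℕ} (j m : ℕ) (p : ℕ → ℕ → ℕ) (i : Fin n) (h1 : (i : ℕ) ≠ m)
    (h2 : (i : ℕ) ≠ m + 1) : wt n (bk j m p) i = wt n p i := by
  rw [wt, wt, U_bk_ne _ _ _ _ _ _ (by omega), U_bk_ne _ _ _ _ _ _ (by omega)]

section
variable {n : ℕ} {A : ℕ → ℕ} {p : ℕ → ℕ → ℕ}

lemma wt_bk_symm (h : IsGT n A p) (m : ℕ) (hm : m + 1 < n) :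
    wt n (bk (A 0) m p) = wt n p ∘ Equiv.swap ⟨m, by omega⟩ ⟨m + 1, hm⟩ := by
  have h1 := U_bk_add h (A 0) m hm (fun s hs => by have := h.le_A (m + 1) s; omega)
  rw [h.U_large _ _ le_rfl, h.U_large _ _ le_rfl, h.U_large _ _ le_rfl] at h1
  have a := h.U_mono m 0
  have b : U n p (m + 1) 0 ≤ U n p (m + 2) 0 := h.U_mono (m + 1) 0
  apply eq_comp_swap
  · simp only [wt]
    rw [U_bk_ne _ _ _ _ m _ (by omega)]
    have : m + 1 + 1 = m + 2 := rfl
    rw [this]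
    omega
  · simp only [wt]
    rw [U_bk_ne _ _ _ _ (m + 1 + 1) _ (by omega)]
    have : m + 1 + 1 = m + 2 := rfl
    rw [this]
    omega
  · intro i hi1 hi2
    exact wt_bk_ne _ _ _ _ (fun h => hi1 (Fin.ext h)) (fun h => hi2 (Fin.ext h))

lemma shift_bk {B : ℕ → ℕ} {j m : ℕ} (h : IsGT n A p) (hc : Cls n B p j m) :
    shift n ((fun i : Fin n => B i) + wt n (bk j m p)) =
      shift n ((fun i : Fin n => B i) + wt n p) ∘
        Equiv.swap ⟨m, by have := hc.1.1; omega⟩ ⟨m + 1, hc.1.1⟩ := by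
  have h1 := cls_eq h hc
  have hm := hc.1.1
  have a := h.U_mono m 0
  have b : U n p (m + 1) 0 ≤ U n p (m + 2) 0 := h.U_mono (m + 1) 0
  have a' := (bk_isGT h j m hm).U_mono m 0
  have b' := (bk_isGT h j m hm).U_mono (m + 1) 0
  rw [U_bk_ne _ _ _ _ m _ (by omega)] at a'
  rw [U_bk_ne _ _ _ _ (m + 1 + 1) _ (by omega)] at b'
  have e : m + 1 + 1 = m + 2 := rfl
  rw [e] at b'
  apply eq_comp_swap
  · simp only [shift, wt, Pi.add_apply]
    rw [U_bk_ne _ _ _ _ m _ (by omega), e]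
    omega
  · simp only [shift, wt, Pi.add_apply]
    rw [U_bk_ne _ _ _ _ (m + 1 + 1) _ (by omega), e]
    omega
  · intro i hi1 hi2
    simp only [shift, Pi.add_apply]
    rw [wt_bk_ne _ _ _ _ (fun h => hi1 (Fin.ext h)) (fun h => hi2 (Fin.ext h))]

end

/-- Generating polynomial of the Gelfand–Tsetlin patterns. -/
noncomputable def gtPoly (n : ℕ) (A : ℕ → ℕ) : MvPolynomial (Fin n) ℤ :=
  ∑ p ∈ gts n A, ∏ i, X i ^ wt n p i

lemma gtPoly_swap (n : ℕ) (A : ℕ → ℕ) (m : ℕ) (hm : m + 1 < n) :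
    rename (Equiv.swap (⟨m, by omega⟩ : Fin n) ⟨m + 1, hm⟩) (gtPoly n A) = gtPoly n A := by
  rw [gtPoly, map_sum]
  refine Finset.sum_nbij' (bk (A 0) m) (bk (A 0) m) ?_ ?_ ?_ ?_ ?_
  · intro p hp; rw [mem_gts] at *; exact bk_isGT hp _ _ hm
  · intro p hp; rw [mem_gts] at *; exact bk_isGT hp _ _ hm
  · intro p hp; rw [mem_gts] at *; exact bk_bk hp _ _ hm
  · intro p hp; rw [mem_gts] at *; exact bk_bk hp _ _ hm
  · intro p hp
    rw [mem_gts] at hp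
    rw [wt_bk_symm hp m hm]
    simp only [map_prod, map_pow, rename_X]
    rw [← Equiv.prod_comp (Equiv.swap (⟨m, by omega⟩ : Fin n) ⟨m + 1, hm⟩)]
    simp

lemma gtPoly_symm (n : ℕ) (A : ℕ → ℕ) (σ : Equiv.Perm (Fin n)) :
    rename σ (gtPoly n A) = gtPoly n A := by
  cases n with
  | zero =>
    have : σ = 1 := Subsingleton.elim _ _
    subst this
    simp [Equiv.Perm.coe_one]
  | succ n =>
    have hσ : σ ∈ Submonoid.closure
        (Set.range fun i : Fin n => Equiv.swap i.castSucc i.succ) := by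
      rw [Equiv.Perm.mclosure_swap_castSucc_succ]; trivial
    induction hσ using Submonoid.closure_induction with
    | mem x hx =>
      obtain ⟨i, rfl⟩ := hx
      exact gtPoly_swap (n + 1) A i (by omega)
    | one => simp [Equiv.Perm.coe_one]
    | mul x y _ _ hx hy =>
      rw [Equiv.Perm.coe_mul, ← rename_rename, hy, hx]

def Good (n : ℕ) (B : ℕ → ℕ) (p : ℕ → ℕ → ℕ) : Prop := ∀ j m, ¬ Bad n B p j m

open Classical in
lemma alt_mul_gtPoly (n : ℕ) (A B : ℕ → ℕ) (hB : Antitone B) :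
    alt n (shift n fun i => B i) * gtPoly n A =
      ∑ p ∈ (gts n A).filter (Good n B), alt n (shift n ((fun i : Fin n => B i) + wt n p)) := by
  rw [alt_mul n _ (gts n A) (wt n) (gtPoly n A) rfl (gtPoly_symm n A)]
  have e : ∀ w : Fin n → ℕ, shift n (fun i => B i) + w = shift n ((fun i : Fin n => B i) + w) := by
    intro w; ext i; simp only [shift, Pi.add_apply]; omega
  simp only [e]
  rw [← Finset.sum_filter_add_sum_filter_not (gts n A) (Good n B), add_eq_left]
  have hex : ∀ p ∈ (gts n A).filter (fun p => ¬ Good n B p), ∃ jm : ℕ × ℕ, Cls n B p jm.1 jm.2 := by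
    intro p hp
    rw [Finset.mem_filter, mem_gts] at hp
    obtain ⟨j, m, h⟩ := exists_cls hB hp.1 (by simpa [Good] using hp.2)
    exact ⟨(j, m), h⟩
  have hf : ∀ p (hp : p ∈ (gts n A).filter (fun p => ¬ Good n B p)),
      alt n (shift n ((fun i : Fin n => B i) + wt n p)) + alt n (shift n ((fun i : Fin n => B i) +
        wt n (bk (hex p hp).choose.1 (hex p hp).choose.2 p))) = 0 := by
    intro p hp
    have hc := (hex p hp).choose_spec
    rw [Finset.mem_filter, mem_gts] at hp
    rw [shift_bk hp.1 hc, alt_perm, Equiv.Perm.sign_swap]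
    · simp
    · simp
  have hmem : ∀ p (hp : p ∈ (gts n A).filter (fun p => ¬ Good n B p)),
      bk (hex p hp).choose.1 (hex p hp).choose.2 p ∈
        (gts n A).filter (fun p => ¬ Good n B p) := by
    intro p hp
    have hc := (hex p hp).choose_spec
    have hp' := hp
    rw [Finset.mem_filter, mem_gts] at hp
    rw [Finset.mem_filter, mem_gts]
    exact ⟨bk_isGT hp.1 _ _ hc.1.1, fun hg => hg _ _ (cls_bk hp.1 hc).1⟩
  refine Finset.sum_involution (fun p hp => bk (hex p hp).choose.1 (hex p hp).choose.2 p)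
    hf ?_ hmem ?_
  · intro p hp hne heq
    have := hf p hp
    rw [heq] at this
    exact hne (by rwa [add_self_eq_zero] at this)
  · intro p hp
    have hc := (hex p hp).choose_spec
    have hc' := (hex _ (hmem p hp)).choose_spec
    have hgt : IsGT n A p := mem_gts.1 (Finset.mem_filter.1 hp).1
    have hu := cls_unique (cls_bk hgt hc) hc'
    rw [← hu.1, ← hu.2]
    exact bk_bk hgt _ _ hc.1.1

/-- The superstandard pattern. -/
def sst (A : ℕ → ℕ) : ℕ → ℕ → ℕ := fun r s => if s < r then A s else 0

lemma sst_isGT (n : ℕ) (A : ℕ → ℕ) (hA : Antitone A) (hA0 : ∀ s, n ≤ s → A s = 0) :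
    IsGT n A (sst A) where
  zero s := by simp [sst]
  up r s := by simp only [sst]; split_ifs <;> omega
  dn r s := by
    have : A (s + 1) ≤ A s := hA (Nat.le_succ s)
    simp only [sst]; split_ifs <;> omega
  top r s hr := by
    have := hA0 s
    simp only [sst]; split_ifs <;> omega

lemma U_sst (n : ℕ) (A : ℕ → ℕ) (r j : ℕ) (hr : r ≤ n) :
    U n (sst A) r j = ∑ s ∈ range r, (A s - j) := by
  rw [U]
  symm
  rw [← Finset.sum_subset (s₁ := range r) (s₂ := range n)]
  · refine Finset.sum_congr rfl fun s hs => ?_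
    simp only [Finset.mem_range] at hs
    simp [sst, hs]
  · intro x hx; simp at *; omega
  · intro x _ hx
    simp only [Finset.mem_range] at hx
    simp [sst, hx]

lemma wt_sst (n : ℕ) (A : ℕ → ℕ) : wt n (sst A) = fun i : Fin n => A i := by
  ext i
  rw [wt, U_sst _ _ _ _ (by omega), U_sst _ _ _ _ (by omega), Finset.sum_range_succ]
  omega

lemma sst_good (n : ℕ) (A : ℕ → ℕ) (hA : Antitone A) : Good n 0 (sst A) := by
  rintro j m ⟨hm, hb⟩
  have : A (m + 1) ≤ A m := hA (Nat.le_succ m)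
  rw [U_sst _ _ _ _ (by omega), U_sst _ _ _ _ (by omega), U_sst _ _ _ _ (by omega),
    Finset.sum_range_succ _ (m + 1), Finset.sum_range_succ] at hb
  simp only [Pi.zero_apply] at hb
  omega

lemma good_zero_eq (n : ℕ) (A : ℕ → ℕ) (p : ℕ → ℕ → ℕ) (h : IsGT n A p) (hg : Good n 0 p) :
    p = sst A := by
  have hcon : ∀ j m, m + 1 < n → U n p (m + 2) j + U n p m j ≤ 2 * U n p (m + 1) j := by
    intro j m hm
    have := hg j m
    simp only [Bad, Pi.zero_apply, zero_add] at this
    by_contra hh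
    exact this ⟨hm, by omega⟩
  have key : ∀ s, s < n → p (s + 1) s = A s := by
    intro s
    induction s using Nat.strong_induction_on with
    | _ s ih =>
      intro hs
      have hq : ∀ q r, q < s → q < r → p r q = A q := by
        intro q r hq hr
        have h1 := ih q hq (by omega)
        have h2 := h.mono q (show q + 1 ≤ r by omega)
        have h3 := h.le_top r q
        simp only at h2
        omega
      have e1 : ∀ j, j = p (s + 1) s → U n p (s + 1) j = U n p s j := by
        rintro j hj
        refine Finset.sum_congr rfl fun q _ => ?_
        rcases lt_trichotomy q s with h1 | h1 | h1
        · rw [hq q _ h1 (by omega), hq q _ h1 h1]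
        · subst h1
          rw [← hj, h.eq_zero q q le_rfl]
          omega
        · rw [h.eq_zero _ _ (by omega), h.eq_zero _ _ (by omega)]
      have e1 := e1 _ rfl
      generalize hj : p (s + 1) s = j at e1 ⊢
      have e2 : ∀ d, s + 1 + d ≤ n → U n p (s + 1 + d) j ≤ U n p (s + d) j := by
        intro d
        induction d with
        | zero => intro _; exact e1.le
        | succ d ihd =>
          intro hd
          have h1 := ihd (by omega)
          have h2 := hcon j (s + d) (by omega)
          rw [show s + 1 + d = s + d + 1 by omega] at h1
          rw [show s + 1 + (d + 1) = s + d + 2 by omega, show s + (d + 1) = s + d + 1 by omega]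
          omega
      have e3 : ∀ d, s + d ≤ n → U n p (s + d) j ≤ U n p s j := by
        intro d
        induction d with
        | zero => intro _; exact le_rfl
        | succ d ihd =>
          intro hd
          have h1 := ihd (by omega)
          have h2 := e2 d (by omega)
          rw [show s + 1 + d = s + (d + 1) by omega] at h2
          omega
      have e4 := e3 (n - s) (by omega)
      rw [show s + (n - s) = n by omega] at e4
      have hle : ∀ q ∈ range n, p s q - j ≤ p n q - j := fun q _ =>
        Nat.sub_le_sub_right (h.mono q hs.le) j
      have e5 : U n p s j = U n p n j := le_antisymm (Finset.sum_le_sum hle) e4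
      have e6 := (Finset.sum_eq_sum_iff_of_le hle).1 e5 s (by simpa using hs)
      rw [h.eq_zero s s le_rfl, h.top n s le_rfl] at e6
      have := h.le_top (s + 1) s
      omega
  ext r s
  simp only [sst]
  split_ifs with hs
  · by_cases hsn : s < n
    · have h1 := key s hsn
      have h2 := h.mono s (show s + 1 ≤ r by omega)
      have h3 := h.le_top r s
      simp only at h2
      omega
    · exact h.top r s (by omega)
  · exact h.eq_zero _ _ (by omega)

/-- Extend a tuple by zero. -/
def extd (n : ℕ) (B : Fin n → ℕ) : ℕ → ℕ := fun r => if h : r < n then B ⟨r, h⟩ else 0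

lemma extd_val (n : ℕ) (B : Fin n → ℕ) : (fun i : Fin n => extd n B i) = B := by
  ext i; simp [extd]

lemma extd_anti (n : ℕ) (B : Fin n → ℕ) (hB : Antitone B) : Antitone (extd n B) := by
  intro a b hab
  simp only [extd]
  split_ifs with h1 h2
  · exact hB hab
  · omega
  · omega
  · omega

lemma extd_zero (n : ℕ) (B : Fin n → ℕ) (s : ℕ) (hs : n ≤ s) : extd n B s = 0 := by
  simp [extd, hs]

lemma gtPoly_eq_schur (n : ℕ) (A : Fin n → ℕ) (hA : Antitone A) :
    gtPoly n (extd n A) = schur n A := by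
  classical
  have h1 := alt_mul_gtPoly n (extd n A) 0 (fun _ _ _ => le_rfl)
  have h2 : (gts n (extd n A)).filter (Good n 0) = {sst (extd n A)} := by
    ext p
    rw [Finset.mem_filter, mem_gts, Finset.mem_singleton]
    constructor
    · rintro ⟨h, hg⟩; exact good_zero_eq n _ p h hg
    · rintro rfl
      exact ⟨sst_isGT n _ (extd_anti n A hA) (extd_zero n A), sst_good n _ (extd_anti n A hA)⟩
  rw [h2, Finset.sum_singleton, wt_sst, extd_val] at h1
  have h3 := schur_mul_vdm_s7 n A
  apply mul_left_cancel₀ (vdm_ne_zero n)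
  rw [mul_comm _ (schur n A), h3, vdm_eq_s7]
  have e0 : (fun i : Fin n => (0 : ℕ → ℕ) i) = 0 := rfl
  rw [e0, zero_add] at h1
  exact h1

/-- Nonnegative combinations of alternants of partitions. -/
noncomputable def Cone (n : ℕ) : AddSubmonoid (MvPolynomial (Fin n) ℤ) :=
  AddSubmonoid.closure {Q | ∃ B : Fin n → ℕ, Antitone B ∧ Q = alt n (shift n B)}

lemma good_anti (n : ℕ) (A B : ℕ → ℕ) (p : ℕ → ℕ → ℕ) (h : IsGT n A p) (hg : Good n B p) :
    Antitone ((fun i : Fin n => B i) + wt n p) := by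
  cases n with
  | zero => intro a; exact a.elim0
  | succ n =>
    rw [Fin.antitone_iff_succ_le]
    intro i
    have h1 := hg 0 i
    simp only [Bad, not_and, not_lt] at h1
    have h1 := h1 (by omega)
    have a := h.U_mono i 0
    have b := h.U_mono (i + 1) 0
    simp only [Pi.add_apply, wt, Fin.val_succ, Fin.val_castSucc]
    have e : (i : ℕ) + 1 + 1 = i + 2 := rfl
    rw [e] at *
    omega

lemma alt_mul_schur_mem (n : ℕ) (A B : Fin n → ℕ) (hA : Antitone A) (hB : Antitone B) :
    alt n (shift n B) * schur n A ∈ Cone n := by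
  classical
  have h := alt_mul_gtPoly n (extd n A) (extd n B) (extd_anti n B hB)
  rw [extd_val, gtPoly_eq_schur n A hA] at h
  rw [h]
  refine sum_mem fun p hp => AddSubmonoid.subset_closure ⟨_, ?_, rfl⟩
  rw [Finset.mem_filter, mem_gts] at hp
  have := good_anti n _ _ p hp.1 hp.2
  rwa [extd_val] at this

lemma cone_mul_schur (n : ℕ) (A : Fin n → ℕ) (hA : Antitone A) (Q : MvPolynomial (Fin n) ℤ)
    (hQ : Q ∈ Cone n) : Q * schur n A ∈ Cone n := by
  induction hQ using AddSubmonoid.closure_induction with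
  | mem x hx =>
    obtain ⟨B, hB, rfl⟩ := hx
    exact alt_mul_schur_mem n A B hA hB
  | zero => rw [zero_mul]; exact zero_mem _
  | add x y _ _ hx hy => rw [add_mul]; exact add_mem hx hy

lemma alt_mul_schur_step (n : ℕ) (A : Fin n → ℕ) (hA : Antitone A) (B : ℕ → ℕ) (hB : Antitone B)
    (p : ℕ → ℕ → ℕ) (h : IsGT n (extd n A) p) (hg : Good n B p) :
    ∃ Q ∈ Cone n, alt n (shift n fun i => B i) * schur n A =
      alt n (shift n ((fun i : Fin n => B i) + wt n p)) + Q := by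
  classical
  have h1 := alt_mul_gtPoly n (extd n A) B hB
  rw [gtPoly_eq_schur n A hA] at h1
  rw [h1, ← Finset.add_sum_erase _ _ (Finset.mem_filter.2 ⟨mem_gts.2 h, hg⟩)]
  refine ⟨_, sum_mem fun q hq => AddSubmonoid.subset_closure ⟨_, ?_, rfl⟩, rfl⟩
  rw [Finset.mem_erase, Finset.mem_filter, mem_gts] at hq
  exact good_anti n _ _ q hq.2.1 hq.2.2

lemma coeff_cone (n : ℕ) (C : Fin n → ℕ) (hC : Antitone C) (Q : MvPolynomial (Fin n) ℤ)
    (hQ : Q ∈ Cone n) : 0 ≤ coeff (Finsupp.equivFunOnFinite.symm (shift n C)) Q := by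
  induction hQ using AddSubmonoid.closure_induction with
  | mem x hx =>
    obtain ⟨B, hB, rfl⟩ := hx
    rw [coeff_alt _ _ _ (shift_strictAnti n B hB) (shift_strictAnti n C hC)]
    split_ifs <;> simp
  | zero => simp
  | add x y _ _ hx hy => rw [coeff_add]; exact add_nonneg hx hy

/-- Positivity from a chain of good patterns. -/
lemma chain_pos (n : ℕ) (A : Fin n → ℕ) (hA : Antitone A) (B : ℕ → ℕ → ℕ)
    (hB0 : ∀ i, B 0 i = 0) (hB : ∀ t, Antitone (B t)) (p : ℕ → ℕ → ℕ → ℕ)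
    (hp : ∀ t, IsGT n (extd n A) (p t)) (hg : ∀ t, Good n (B t) (p t))
    (hw : ∀ t, (i : Fin n) → B (t + 1) i = B t i + wt n (p t) i) (t : ℕ) :
    0 < schurMult n (fun i => B t i) (schur n A ^ t) := by
  have key : ∃ Q ∈ Cone n, schur n A ^ t * vdm n = alt n (shift n fun i => B t i) + Q := by
    induction t with
    | zero =>
      refine ⟨0, zero_mem _, ?_⟩
      have : (fun i : Fin n => B 0 i) = 0 := by ext i; exact hB0 i
      rw [this, vdm_eq_s7]; simp
    | succ t ih =>
      obtain ⟨Q, hQ, h⟩ := ih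
      obtain ⟨Q', hQ', h'⟩ := alt_mul_schur_step n A hA (B t) (hB t) (p t) (hp t) (hg t)
      refine ⟨Q' + Q * schur n A, add_mem hQ' (cone_mul_schur n A hA Q hQ), ?_⟩
      have e : (fun i : Fin n => B (t + 1) i) = (fun i : Fin n => B t i) + wt n (p t) := by
        ext i; exact hw t i
      rw [pow_succ, mul_right_comm, h, add_mul, h', e]
      ring
  obtain ⟨Q, hQ, h⟩ := key
  have hanti : Antitone (fun i : Fin n => B t i) := fun a b hab => hB t hab
  have h1 : schurMult n (fun i => B t i) (schur n A ^ t) =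
      coeff (Finsupp.equivFunOnFinite.symm (shift n fun i => B t i))
        (schur n A ^ t * vdm n) := rfl
  rw [h1, h, coeff_add, coeff_alt _ _ _ (shift_strictAnti n _ hanti) (shift_strictAnti n _ hanti),
    if_pos rfl]
  have := coeff_cone n _ hanti Q hQ
  omega

lemma sum_sub_add (f : ℕ → ℕ) (t j : ℕ) (h : ∀ s, s < t → j ≤ f s) :
    ∑ s ∈ range t, (f s - j) + t * j = ∑ s ∈ range t, f s := by
  induction t with
  | zero => simp
  | succ t ih =>
    rw [Finset.sum_range_succ, Finset.sum_range_succ, ← ih fun s hs => h s (by omega), add_mul]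
    have := h t (by omega)
    omega

lemma U_trunc (n : ℕ) (p : ℕ → ℕ → ℕ) (r j t : ℕ) (ht : t ≤ n) (h : ∀ s, t ≤ s → p r s ≤ j) :
    U n p r j = ∑ s ∈ range t, (p r s - j) := by
  symm
  refine Finset.sum_subset (fun x hx => ?_) fun x _ hx => ?_
  · simp at *; omega
  · simp at hx
    have := h x hx
    omega

/-- The linear Littlewood–Richardson conditions imply goodness. -/
lemma good_of_linear (n : ℕ) (A B : ℕ → ℕ) (p : ℕ → ℕ → ℕ) (h : IsGT n A p)
    (hl : ∀ m P, m + 1 < n →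
      B (m + 1) + ∑ q ∈ range (P + 1), p (m + 2) q + ∑ q ∈ range P, p m q ≤
        B m + ∑ q ∈ range (P + 1), p (m + 1) q + ∑ q ∈ range P, p (m + 1) q) :
    Good n B p := by
  classical
  rintro j m ⟨hm, hb⟩
  have hex : ∃ s, p (m + 1) s ≤ j := ⟨m + 1, by rw [h.eq_zero _ _ le_rfl]; omega⟩
  obtain ⟨t, ht1, ht2, ht3⟩ : ∃ t, t ≤ m + 1 ∧ p (m + 1) t ≤ j ∧ ∀ s, s < t → j < p (m + 1) s := by
    refine ⟨Nat.find hex, Nat.find_min' hex ?_, Nat.find_spec hex, fun s hs => ?_⟩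
    · rw [h.eq_zero _ _ le_rfl]; omega
    · exact not_le.1 (Nat.find_min hex hs)
  have ht4 : ∀ s, t ≤ s → p (m + 1) s ≤ j := fun s hs => (h.anti _ hs).trans ht2
  have e1 := U_trunc n p (m + 1) j t (by omega) ht4
  have e0 := U_trunc n p m j t (by omega) fun s hs => (h.up m s).trans (ht4 s hs)
  have e2 := U_trunc n p (m + 2) j (t + 1) (by omega) fun s hs => by
    obtain ⟨s, rfl⟩ : ∃ s', s = s' + 1 := ⟨s - 1, by omega⟩
    exact (h.dn (m + 1) s).trans (ht4 s (by omega))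
  rw [Finset.sum_range_succ] at e2
  have f1 := sum_sub_add (p (m + 1)) t j fun s hs => (ht3 s hs).le
  have f2 := sum_sub_add (p (m + 2)) t j fun s hs => ((ht3 s hs).trans_le (h.up _ s)).le
  have g := h.up (m + 1) t
  have g : p (m + 1) t ≤ p (m + 2) t := g
  by_cases hc : ∀ s, s < t → j ≤ p m s
  · have f0 := sum_sub_add (p m) t j hc
    have l := hl m t hm
    rw [Finset.sum_range_succ, Finset.sum_range_succ] at l
    omega
  · push Not at hc
    obtain ⟨s, hs, hsj⟩ := hc
    obtain ⟨t, rfl⟩ : ∃ t', t = t' + 1 := ⟨t - 1, by omega⟩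
    have hst : s = t := by
      by_contra hne
      have h1 := ht3 (s + 1) (by omega)
      have h2 := h.dn m s
      omega
    subst hst
    have f0 := sum_sub_add (p m) s j fun s' hs' => by
      have h1 := ht3 (s' + 1) (by omega)
      have h2 := h.dn m s'
      omega
    have l := hl m s hm
    have g2 : p (m + 2) (s + 1) ≤ p (m + 1) s := h.dn (m + 1) s
    have g3 := ht3 s (by omega)
    have g4 : p (m + 1) s ≤ p (m + 2) s := h.up (m + 1) s
    simp only [Finset.sum_range_succ, add_mul, one_mul] at *
    omega

/-- Balanced filling of `M` boxes in `n` rows: the length of row `r`. -/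
def bt (n M r : ℕ) : ℕ := M / n + if r < M % n then 1 else 0

lemma div_mod_cases (n M k : ℕ) (hn : 0 < n) (hk : k ≤ n) :
    ((M + k) / n = M / n ∧ (M + k) % n = M % n + k) ∨
    ((M + k) / n = M / n + 1 ∧ (M + k) % n + n = M % n + k) := by
  have h1 := Nat.div_add_mod M n
  have h2 := Nat.mod_lt M hn
  by_cases h : M % n + k < n
  · left
    have := (Nat.div_mod_unique (a := M + k) (d := M / n) (c := M % n + k) hn).2 ⟨by omega, h⟩
    exact this
  · right
    have := (Nat.div_mod_unique (a := M + k) (d := M / n + 1) (c := M % n + k - n) hn).2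
      ⟨by rw [mul_add, mul_one]; omega, by omega⟩
    omega

lemma bt_step (n M k r : ℕ) (hn : 0 < n) (hk : k ≤ n) (hr : r < n) :
    bt n M r ≤ bt n (M + k) r ∧ bt n (M + k) r ≤ bt n M r + 1 := by
  have h2 := Nat.mod_lt M hn
  simp only [bt]
  rcases div_mod_cases n M k hn hk with ⟨h, h'⟩ | ⟨h, h'⟩
  · rw [h, h']; split_ifs <;> omega
  · rw [h]; split_ifs <;> omega

lemma bt_anti (n M : ℕ) : Antitone (bt n M) := by
  intro a b hab
  simp only [bt]
  split_ifs <;> omega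

lemma sum_bt (n M : ℕ) (hn : 0 < n) : ∑ r ∈ range n, bt n M r = M := by
  have key : ∀ r, ∑ r' ∈ range r, bt n M r' = (M / n) * r + min (M % n) r := by
    intro r
    induction r with
    | zero => simp
    | succ r ih =>
      rw [Finset.sum_range_succ, ih, bt, mul_add, mul_one]
      split_ifs <;> omega
  rw [key, min_eq_left (Nat.mod_lt M hn).le, mul_comm]
  exact Nat.div_add_mod M n

/-- Number of letters `< r` in the column of height `k` added to `M` boxes. -/
def NN (n M k r : ℕ) : ℕ := ∑ r' ∈ range r, if r' < n then bt n (M + k) r' - bt n M r' else 0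

lemma NN_succ (n M k r : ℕ) (hn : 0 < n) (hk : k ≤ n) (hr : r < n) :
    NN n M k (r + 1) + bt n M r = NN n M k r + bt n (M + k) r := by
  have := bt_step n M k r hn hk hr
  rw [NN, Finset.sum_range_succ, ← NN, if_pos hr]
  omega

lemma NN_step (n M k r : ℕ) (hn : 0 < n) (hk : k ≤ n) :
    NN n M k r ≤ NN n M k (r + 1) ∧ NN n M k (r + 1) ≤ NN n M k r + 1 := by
  by_cases hr : r < n
  · have := bt_step n M k r hn hk hr
    have := NN_succ n M k r hn hk hr
    omega
  · have : NN n M k (r + 1) = NN n M k r := by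
      rw [NN, Finset.sum_range_succ, ← NN, if_neg hr, add_zero]
    omega

lemma NN_top (n M k r : ℕ) (hn : 0 < n) (hk : k ≤ n) (hr : n ≤ r) : NN n M k r = k := by
  induction r, hr using Nat.le_induction with
  | base =>
    have key : ∀ r, r ≤ n → NN n M k r + ∑ r' ∈ range r, bt n M r' =
        ∑ r' ∈ range r, bt n (M + k) r' := by
      intro r
      induction r with
      | zero => simp [NN]
      | succ r ih =>
        intro hr
        have h1 := ih (by omega)
        have h2 := NN_succ n M k r hn hk (by omega)
        rw [Finset.sum_range_succ, Finset.sum_range_succ]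
        omega
    have := key n le_rfl
    rw [sum_bt n _ hn, sum_bt n _ hn] at this
    omega
  | succ r hr ih =>
    rw [NN, Finset.sum_range_succ, ← NN, if_neg (by omega), ih, add_zero]

lemma NN_le (n M k r : ℕ) (hn : 0 < n) (hk : k ≤ n) : NN n M k r ≤ n := by
  rcases le_total n r with hr | hr
  · rw [NN_top n M k r hn hk hr]; exact hk
  · have hm : Monotone (NN n M k) := monotone_nat_of_le_succ fun r => (NN_step n M k r hn hk).1
    exact (hm hr).trans ((NN_top n M k n hn hk le_rfl).trans_le hk)

/-- Column heights. -/
def kk (n : ℕ) (A : ℕ → ℕ) (c : ℕ) : ℕ := ((range n).filter fun s => c < A s).card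

lemma kk_le (n : ℕ) (A : ℕ → ℕ) (c : ℕ) : kk n A c ≤ n := by
  have := Finset.card_filter_le (range n) (fun s => c < A s)
  rwa [Finset.card_range] at this

lemma lt_kk (n : ℕ) (A : ℕ → ℕ) (hA : Antitone A) (hA0 : ∀ s, n ≤ s → A s = 0) (c s : ℕ) :
    s < kk n A c ↔ c < A s := by
  constructor
  · intro h
    by_contra hc
    have : ((range n).filter fun s => c < A s) ⊆ range s := by
      intro x hx
      rw [Finset.mem_filter] at hx
      rw [Finset.mem_range]
      by_contra hxs
      have := hA (not_lt.1 hxs)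
      omega
    have := Finset.card_le_card this
    rw [Finset.card_range] at this
    rw [kk] at h
    omega
  · intro h
    have hs : s < n := by
      by_contra hs
      rw [hA0 s (by omega)] at h
      omega
    have : range (s + 1) ⊆ ((range n).filter fun s => c < A s) := by
      intro x hx
      rw [Finset.mem_range] at hx
      rw [Finset.mem_filter, Finset.mem_range]
      have := hA (show x ≤ s by omega)
      omega
    have := Finset.card_le_card this
    rw [Finset.card_range] at this
    rw [kk]
    omega

lemma sum_ind (a N : ℕ) (h : a ≤ N) : (∑ c ∈ range N, if c < a then 1 else 0) = a := by
  rw [← Finset.card_filter]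
  have : (range N).filter (fun c => c < a) = range a := by
    ext x; simp; omega
  rw [this, Finset.card_range]

lemma sum_ind_min (a N : ℕ) : (∑ c ∈ range N, if c < a then 1 else 0) = min a N := by
  rw [← Finset.card_filter]
  have : (range N).filter (fun c => c < a) = range (min a N) := by
    ext x; simp; omega
  rw [this, Finset.card_range]

/-- The pattern used in step `t`. -/
def pat (n : ℕ) (A : ℕ → ℕ) (t r s : ℕ) : ℕ :=
  ∑ c ∈ range (A 0), if s < NN n (t * kk n A c) (kk n A c) r then 1 else 0

/-- The partition reached after `t` steps. -/
def Bt (n : ℕ) (A : ℕ → ℕ) (t r : ℕ) : ℕ := ∑ c ∈ range (A 0), bt n (t * kk n A c) r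

lemma sum_pat (n : ℕ) (A : ℕ → ℕ) (t r P : ℕ) :
    ∑ q ∈ range P, pat n A t r q =
      ∑ c ∈ range (A 0), min (NN n (t * kk n A c) (kk n A c) r) P := by
  simp only [pat]
  rw [Finset.sum_comm]
  exact Finset.sum_congr rfl fun c _ => sum_ind_min _ _

lemma pat_isGT (n : ℕ) (hn : 0 < n) (A : ℕ → ℕ) (hA : Antitone A) (hA0 : ∀ s, n ≤ s → A s = 0)
    (t : ℕ) : IsGT n A (pat n A t) where
  zero s := by simp [pat, NN]
  up r s := by
    refine Finset.sum_le_sum fun c _ => ?_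
    have := NN_step n (t * kk n A c) (kk n A c) r hn (kk_le n A c)
    split_ifs <;> omega
  dn r s := by
    refine Finset.sum_le_sum fun c _ => ?_
    have := NN_step n (t * kk n A c) (kk n A c) r hn (kk_le n A c)
    split_ifs <;> omega
  top r s hr := by
    have : pat n A t r s = ∑ c ∈ range (A 0), if c < A s then 1 else 0 := by
      refine Finset.sum_congr rfl fun c _ => ?_
      rw [NN_top n _ _ r hn (kk_le n A c) hr]
      simp only [lt_kk n A hA hA0]
    rw [this]
    exact sum_ind _ _ (hA (Nat.zero_le s))

lemma pat_good (n : ℕ) (hn : 0 < n) (A : ℕ → ℕ) (hA : Antitone A) (hA0 : ∀ s, n ≤ s → A s = 0)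
    (t : ℕ) : Good n (Bt n A t) (pat n A t) := by
  refine good_of_linear n A _ _ (pat_isGT n hn A hA hA0 t) fun m P hm => ?_
  simp only [sum_pat, Bt, ← Finset.sum_add_distrib]
  refine Finset.sum_le_sum fun c _ => ?_
  have hk := kk_le n A c
  generalize kk n A c = k at *
  generalize t * k = M
  have h1 := NN_succ n M k m hn hk (by omega)
  have h2 : NN n M k (m + 2) + bt n M (m + 1) = NN n M k (m + 1) + bt n (M + k) (m + 1) :=
    NN_succ n M k (m + 1) hn hk hm
  have h3 := bt_step n M k m hn hk (by omega)
  have h4 := bt_step n M k (m + 1) hn hk (by omega)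
  have h5 : bt n M (m + 1) ≤ bt n M m := bt_anti n M (Nat.le_succ m)
  have h6 : bt n (M + k) (m + 1) ≤ bt n (M + k) m := bt_anti n (M + k) (Nat.le_succ m)
  omega

lemma Bt_succ (n : ℕ) (hn : 0 < n) (A : ℕ → ℕ) (t : ℕ) (i : Fin n) :
    Bt n A (t + 1) i = Bt n A t i + wt n (pat n A t) i := by
  have hU : ∀ r, U n (pat n A t) r 0 = ∑ c ∈ range (A 0), NN n (t * kk n A c) (kk n A c) r := by
    intro r
    simp only [U, Nat.sub_zero]
    rw [sum_pat]
    exact Finset.sum_congr rfl fun c _ => min_eq_left (NN_le n _ _ r hn (kk_le n A c))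
  have h1 : Bt n A (t + 1) i + U n (pat n A t) i 0 =
      Bt n A t i + U n (pat n A t) (i + 1) 0 := by
    rw [hU, hU, Bt, Bt, ← Finset.sum_add_distrib, ← Finset.sum_add_distrib]
    refine Finset.sum_congr rfl fun c _ => ?_
    have := NN_succ n (t * kk n A c) (kk n A c) i hn (kk_le n A c) i.isLt
    rw [add_mul, one_mul]
    omega
  have h2 : U n (pat n A t) i 0 ≤ U n (pat n A t) (i + 1) 0 := by
    rw [hU, hU]
    exact Finset.sum_le_sum fun c _ => (NN_step n _ _ i hn (kk_le n A c)).1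
  rw [wt]
  omega

lemma sum_kk (n : ℕ) (A : ℕ → ℕ) (hA : Antitone A) :
    ∑ c ∈ range (A 0), kk n A c = ∑ s ∈ range n, A s := by
  simp only [kk, Finset.card_filter]
  rw [Finset.sum_comm]
  exact Finset.sum_congr rfl fun s _ => sum_ind _ _ (hA (Nat.zero_le s))

lemma Bt_full (n : ℕ) (hn : 0 < n) (A : ℕ → ℕ) (hA : Antitone A) (r : ℕ) :
    Bt n A n r = ∑ s ∈ range n, A s := by
  rw [← sum_kk n A hA]
  refine Finset.sum_congr rfl fun c _ => ?_
  simp [bt, hn]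

lemma Bt_pred (n : ℕ) (hn : 0 < n) (A : ℕ → ℕ) (hA : Antitone A) (hA0 : ∀ s, n ≤ s → A s = 0)
    (r : ℕ) (hr : r < n) :
    Bt n A (n - 1) r + A (n - 1 - r) = ∑ s ∈ range n, A s := by
  rw [← sum_kk n A hA, ← sum_ind (A (n - 1 - r)) (A 0) (hA (Nat.zero_le _)), Bt,
    ← Finset.sum_add_distrib]
  refine Finset.sum_congr rfl fun c hc => ?_
  simp only [← lt_kk n A hA hA0]
  have hk := kk_le n A c
  have hk0 : 0 < kk n A c := (lt_kk n A hA hA0 c 0).2 (by simpa using hc)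
  generalize kk n A c = k at *
  have e : (n - 1) * k + k = n * k := by
    obtain ⟨n, rfl⟩ : ∃ n', n = n' + 1 := ⟨n - 1, by omega⟩
    simp [add_mul]
  have e2 : n * k = n * (k - 1) + n := by
    obtain ⟨k, rfl⟩ : ∃ k', k = k' + 1 := ⟨k - 1, by omega⟩
    simp [mul_add]
  have h := (Nat.div_mod_unique (a := (n - 1) * k) (d := k - 1) (c := n - k) hn).2
    ⟨by omega, by omega⟩
  rw [bt, h.1, h.2]
  split_ifs <;> omega

/-- Let `A` be a partition of length at most `l` with weight `w`. Then
(i) the rectangle `wD(l) = (w,…,w)` has positive multiplicity in `(s_A)^l`, and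
(ii) `wD(l) + χ(A) = (w - a_l, …, w - a_1)` has positive multiplicity in `(s_A)^{l-1}`. -/
theorem rectangle_in_schur_power (l : ℕ) (hl : 0 < l) (A : Fin l → ℕ) (hA : Antitone A) :
    0 < schurMult l (fun _ => ∑ i, A i) ((schur l A) ^ l) ∧
    0 < schurMult l (fun i => (∑ j, A j) - A (Fin.rev i)) ((schur l A) ^ (l - 1)) := by
  have hA1 := extd_anti l A hA
  have hA0 := extd_zero l A
  have key := chain_pos l A hA (Bt l (extd l A)) (fun i => by simp [Bt, bt])
    (fun t a b hab => Finset.sum_le_sum fun c _ => bt_anti l _ hab) (pat l (extd l A))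
    (pat_isGT l hl _ hA1 hA0) (pat_good l hl _ hA1 hA0) (Bt_succ l hl _)
  have hw : ∑ s ∈ range l, extd l A s = ∑ i, A i := by
    rw [← Fin.sum_univ_eq_sum_range]
    exact Finset.sum_congr rfl fun i _ => congrFun (extd_val l A) i
  constructor
  · have h := key l
    have e : (fun i : Fin l => Bt l (extd l A) l i) = fun _ => ∑ i, A i := by
      ext i; rw [Bt_full l hl _ hA1, hw]
    rwa [e] at h
  · have h := key (l - 1)
    have e : (fun i : Fin l => Bt l (extd l A) (l - 1) i) =
        fun i => (∑ j, A j) - A (Fin.rev i) := by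
      ext i
      have h1 := Bt_pred l hl _ hA1 hA0 i i.isLt
      have h2 : extd l A (l - 1 - i) = A (Fin.rev i) := by
        rw [← congrFun (extd_val l A) (Fin.rev i)]
        congr 1
        rw [Fin.val_rev]
        omega
      rw [h2, hw] at h1
      omega
    rwa [e] at h
end
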